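/- arXiv:1508.02065 — 4 statements merged into one kernel-verified Lean document; each statement's English description precedes it below -/
import Mathlib

section
/- Let T₀ and T₁ be nonempty well-founded B-trees. Then for every ordinal ξ, the transfinite derivatives satisfy [T₀,T₁]^{o(T₀)·ξ} = [T₀, T₁^ξ], and consequently o([T₀,T₁]) = o(T₀)·o(T₁) (ordinal multiplication). -/
noncomputable section
open Ordinal

/-- `s` is a proper initial segment of `t`. -/
def SPrefix {S : Type*} (s t : List S) : Prop := s <+: t ∧ s ≠ t

/-- The maximal members of a tree of finite sequences: those with no proper extension. -/
def MaxNodes {S : Type*} (T : Set (List S)) : Set (List S) :=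
  { t ∈ T | ¬ ∃ u ∈ T, SPrefix t u }

/-- A B-tree: a set of nonempty finite sequences which, together with the empty
sequence, is downward closed under the initial segment order. -/
def IsBTree {S : Type*} (T : Set (List S)) : Prop :=
  [] ∉ T ∧ ∀ s t : List S, t ∈ T → s <+: t → s ≠ [] → s ∈ T

/-- The derived tree: members having a proper extension in `T`. -/
def treeDeriv {S : Type*} (T : Set (List S)) : Set (List S) :=
  { s ∈ T | ∃ t ∈ T, SPrefix s t }

/-- Transfinite iterates of the derivative. -/
def derivIter {S : Type*} (T : Set (List S)) (o : Ordinal.{0}) : Set (List S) :=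
  Ordinal.limitRecOn o T (fun _ ih => treeDeriv ih)
    (fun o _ ih => ⋂ p : {p : Ordinal.{0} // p < o}, ih p.1 p.2)

open scoped Classical in
/-- The order `o(T)`, with value `⊤ = ∞` for ill-founded trees. -/
def treeOrder {S : Type*} (T : Set (List S)) : WithTop Ordinal :=
  if _ : ∃ o : Ordinal.{0}, derivIter T o = ∅ then
    ↑(sInf {o : Ordinal.{0} | derivIter T o = ∅}) else ⊤

/-- A tree of finite sequences is well-founded if it has no infinite strictly
increasing chain. -/
def WellFoundedTree {S : Type*} (T : Set (List S)) : Prop :=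
  ¬ ∃ c : ℕ → List S, (∀ n, c n ∈ T) ∧ ∀ n, SPrefix (c n) (c (n + 1))

/-- A monotone map from (a tree) `T` into (a tree) `V`. -/
def MonotoneTreeMap {S₁ S₂ : Type*} (θ : List S₁ → List S₂)
    (T : Set (List S₁)) (V : Set (List S₂)) : Prop :=
  Set.MapsTo θ T V ∧ ∀ s ∈ T, ∀ t ∈ T, SPrefix s t → SPrefix (θ s) (θ t)

/-- An extended monotone map `(θ, e)` from `T` into `V`. -/
def ExtMonotoneTreeMap {S₁ S₂ : Type*} (θ e : List S₁ → List S₂)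
    (T : Set (List S₁)) (V : Set (List S₂)) : Prop :=
  MonotoneTreeMap θ T V ∧ Set.MapsTo e (MaxNodes T) (MaxNodes V) ∧
    ∀ s ∈ MaxNodes T, θ s <+: e s

/-- The B-trees `𝒯_ξ` on the ordinals: `𝒯_1 = {(1)}`,
`𝒯_{ξ+1} = {(ξ+1)} ∪ {(ξ+1)⌢t : t ∈ 𝒯_ξ}`, and `𝒯_ξ = ⋃_{η<ξ} 𝒯_{η+1}` at limits. -/
def calT : Ordinal.{0} → Set (List Ordinal.{0}) := fun ξ =>
  Ordinal.limitRecOn ξ ∅ (fun o ih => {[o + 1]} ∪ (List.cons (o + 1)) '' ih)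
    (fun o _ ih => ⋃ p : {p : Ordinal.{0} // p < o}, ih p.1 p.2)

/-- The tree product `[T₀, T₁]`: concatenations of blocks `(sᵢ, xᵢ^{(|sᵢ|)})` with
`sᵢ ∈ T₀`, all but the last `sᵢ` maximal in `T₀`, and `(xᵢ)ᵢ ∈ T₁`. -/
def treeProd {S₀ S₁ : Type*} (T₀ : Set (List S₀)) (T₁ : Set (List S₁)) :
    Set (List (S₀ × S₁)) :=
  { l | ∃ (k : ℕ) (s : Fin (k + 1) → List S₀) (x : Fin (k + 1) → S₁),
      (∀ i, s i ∈ T₀) ∧ (∀ i : Fin (k + 1), (i : ℕ) < k → s i ∈ MaxNodes T₀) ∧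
      List.ofFn x ∈ T₁ ∧
      l = (List.ofFn fun i => (s i).map fun a => (a, x i)).flatten }

/-- The member `l` of `[𝒯_{ω^ξ}, 𝒯_k]` lies on the `i`-th level, i.e. its unique block
decomposition has `i` blocks; equivalently its last second coordinate is `k - i + 1`. -/
def OnLevel (k i : ℕ) (l : List (Ordinal.{0} × Ordinal.{0})) : Prop :=
  ∃ p : Ordinal.{0} × Ordinal.{0}, l.getLast? = some p ∧ p.2 = ((k - i + 1 : ℕ) : Ordinal.{0})

/-- `U` is a unit of `[𝒯_{ω^ξ}, 𝒯_k]`: either the first level, or the set of proper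
extensions on level `i+1` of some `t` maximal in the `i`-th level. -/
def IsTPUnit (ξ : Ordinal.{0}) (k : ℕ) (U : Set (List (Ordinal.{0} × Ordinal.{0}))) : Prop :=
  U = {l ∈ treeProd (calT (omega0 ^ ξ)) (calT (k : ℕ)) | OnLevel k 1 l} ∨
  ∃ (t : List (Ordinal.{0} × Ordinal.{0})) (i : ℕ), 1 ≤ i ∧ i < k ∧
    t ∈ treeProd (calT (omega0 ^ ξ)) (calT (k : ℕ)) ∧ OnLevel k i t ∧
    (¬ ∃ u ∈ treeProd (calT (omega0 ^ ξ)) (calT (k : ℕ)), SPrefix t u ∧ OnLevel k i u) ∧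
    U = {l ∈ treeProd (calT (omega0 ^ ξ)) (calT (k : ℕ)) | SPrefix t l ∧ OnLevel k (i + 1) l}



namespace TP

inductive Dec {S₀ S₁ : Type*} (T₀ : Set (List S₀)) :
    List (S₀ × S₁) → List S₁ → List S₀ → Prop
  | last (s : List S₀) (x : S₁) (hs : s ∈ T₀) : Dec T₀ (s.map fun a => (a, x)) [x] s
  | cons (s : List S₀) (x : S₁) (hs : s ∈ MaxNodes T₀) (l : List (S₀ × S₁)) (y : List S₁)
      (t : List S₀) (h : Dec T₀ l y t) : Dec T₀ ((s.map fun a => (a, x)) ++ l) (x :: y) t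

theorem Dec.mem {S₀ S₁ : Type*} {T₀ : Set (List S₀)} {l : List (S₀ × S₁)} {y t}
    (h : Dec T₀ l y t) : t ∈ T₀ := by
  induction h with
  | last s x hs => exact hs
  | cons s x hs l y t h ih => exact ih

theorem Dec.ne_nil {S₀ S₁ : Type*} {T₀ : Set (List S₀)} {l : List (S₀ × S₁)} {y t}
    (h : Dec T₀ l y t) : y ≠ [] := by
  cases h <;> simp

theorem Dec.ne_nil' {S₀ S₁ : Type*} {T₀ : Set (List S₀)} {l : List (S₀ × S₁)} {y t}
    (h0 : [] ∉ T₀) (h : Dec T₀ l y t) : l ≠ [] := by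
  induction h with
  | last s x hs => intro h; simp at h; subst h; exact h0 hs
  | cons s x hs l y t h ih => simp [ih]

theorem pre_aux {S₀ S₁ : Type*} {s s' : List S₀} {x x' : S₁} {l' : List (S₀ × S₁)}
    {l : List (S₀ × S₁)}
    (hs : s ≠ []) (hs' : s' ≠ [])
    (h : (s.map fun a => (a, x)) ++ l <+: (s'.map fun a => (a, x')) ++ l') :
    x = x' := by
  cases s with
  | nil => exact absurd rfl hs
  | cons c s =>
    cases s' with
    | nil => exact absurd rfl hs'
    | cons c' s' =>
      simp [List.cons_prefix_cons] at h
      exact h.1.2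

theorem map_pre {S₀ S₁ : Type*} {s s' : List S₀} {x x' : S₁}
    (h : (s.map fun a => (a, x)) <+: (s'.map fun a => (a, x'))) : s <+: s' := by
  have := h.map Prod.fst
  simpa [List.map_map, Function.comp_def] using this

theorem Dec.inv {S₀ S₁ : Type*} {T₀ : Set (List S₀)} (h0 : [] ∉ T₀)
    {l l' : List (S₀ × S₁)} {y y' t t'}
    (h : Dec T₀ l y t) (h' : Dec T₀ l' y' t') (hp : l <+: l') :
    (y = y' ∧ t <+: t' ∧ (t = t' → l = l')) ∨ SPrefix y y' := by
  have hn : ∀ {s}, s ∈ T₀ → s ≠ [] := fun hs e => h0 (e ▸ hs)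
  induction h generalizing l' y' t' with
  | last s x hs =>
    cases h' with
    | last s' x' hs' =>
      left
      have hx : x = x' := pre_aux (l := []) (l' := []) (hn hs) (hn hs') (by simpa using hp)
      subst hx
      refine ⟨rfl, map_pre hp, ?_⟩
      rintro rfl; rfl
    | cons s' x' hs' r y' t' h =>
      right
      have hx : x = x' := pre_aux (l := []) (hn hs) (hn hs'.1) (by simpa using hp)
      subst hx
      have := h.ne_nil
      refine ⟨by simp [List.cons_prefix_cons], ?_⟩
      intro e; simp at e; exact this e
  | cons s x hs r y t h ih =>
    cases h' with
    | last s' x' hs' =>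
      exfalso
      have h1 : s <+: t' := map_pre ((List.prefix_append _ _).trans hp)
      have h2 : s = t' := by
        by_contra hne
        exact hs.2 ⟨t', hs', h1, hne⟩
      subst h2
      have h3 := hp.length_le
      have h4 := h.ne_nil' h0
      simp at h3
      exact h4 h3
    | cons s' x' hs' r' y' t' h' =>
      have hx : x = x' := pre_aux (hn hs.1) (hn hs'.1) hp
      subst hx
      have h1 := (List.prefix_append _ _).trans hp
      have h2 := List.prefix_append (s'.map fun a => (a, x)) r'
      have h3 : s = s' := by
        rcases List.prefix_or_prefix_of_prefix h1 h2 with h | h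
        · by_contra hne
          exact hs.2 ⟨s', hs'.1, map_pre h, hne⟩
        · by_contra hne
          exact hs'.2 ⟨s, hs.1, map_pre h, fun e => hne e.symm⟩
      subst h3
      rw [List.prefix_append_right_inj] at hp
      rcases ih h' hp with ⟨rfl, ht, e⟩ | hh
      · left
        exact ⟨rfl, ht, fun q => by rw [e q]⟩
      · right
        exact ⟨by simpa [List.cons_prefix_cons] using hh.1, by simpa using hh.2⟩

theorem SPrefix.not_pre {S : Type*} {s t : List S} (h : SPrefix s t) (h' : t <+: s) : False :=
  h.2 (h.1.eq_of_length_le h'.length_le)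

theorem Dec.uniq {S₀ S₁ : Type*} {T₀ : Set (List S₀)} (h0 : [] ∉ T₀)
    {l : List (S₀ × S₁)} {y y' t t'}
    (h : Dec T₀ l y t) (h' : Dec T₀ l y' t') : y = y' ∧ t = t' := by
  rcases h.inv h0 h' List.prefix_rfl with ⟨rfl, h1, -⟩ | h1 <;>
  rcases h'.inv h0 h List.prefix_rfl with ⟨h2, h3, -⟩ | h2
  · exact ⟨rfl, h1.eq_of_length_le h3.length_le⟩
  · exact absurd rfl h2.2
  · exact absurd h2.symm h1.2
  · exact (SPrefix.not_pre h1 h2.1).elim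

theorem Dec.sinv {S₀ S₁ : Type*} {T₀ : Set (List S₀)} (h0 : [] ∉ T₀)
    {l l' : List (S₀ × S₁)} {y y' t t'}
    (h : Dec T₀ l y t) (h' : Dec T₀ l' y' t') (hp : SPrefix l l') :
    (y = y' ∧ SPrefix t t') ∨ SPrefix y y' := by
  rcases h.inv h0 h' hp.1 with ⟨h1, h2, h3⟩ | h1
  · exact Or.inl ⟨h1, h2, fun e => hp.2 (h3 e)⟩
  · exact Or.inr h1

theorem Dec.ext1 {S₀ S₁ : Type*} {T₀ : Set (List S₀)}
    {l : List (S₀ × S₁)} {y t t'}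
    (h : Dec T₀ l y t) (ht : t' ∈ T₀) (hp : SPrefix t t') :
    ∃ l', Dec T₀ l' y t' ∧ SPrefix l l' := by
  induction h with
  | last s x hs =>
    refine ⟨_, Dec.last t' x ht, hp.1.map _, ?_⟩
    intro e
    exact hp.2 (List.map_injective_iff.2 (fun a b h => (Prod.ext_iff.1 h).1) e)
  | cons s x hs l y t h ih =>
    obtain ⟨l', h1, h2⟩ := ih hp
    exact ⟨_, Dec.cons s x hs _ _ _ h1, by simpa using h2.1, by simpa using h2.2⟩

theorem Dec.ext2 {S₀ S₁ : Type*} {T₀ : Set (List S₀)} (h0 : [] ∉ T₀)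
    {l : List (S₀ × S₁)} {y t t' m}
    (h : Dec T₀ l y t) (hm : m ∈ MaxNodes T₀) (hp : t <+: m) (ht : t' ∈ T₀) (x : S₁) :
    ∃ l', Dec T₀ l' (y ++ [x]) t' ∧ SPrefix l l' := by
  induction h with
  | last s z hs =>
    refine ⟨_, Dec.cons m z hm _ _ _ (Dec.last t' x ht),
      (hp.map _).trans (List.prefix_append _ _), ?_⟩
    intro e
    have e := congrArg List.length e
    have h1 := hp.length_le
    have : t' ≠ [] := fun e => h0 (e ▸ ht)
    have := List.length_pos_iff.2 this
    simp at e
    omega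
  | cons s z hs l y t h ih =>
    obtain ⟨l', h1, h2⟩ := ih hp
    exact ⟨_, Dec.cons s z hs _ _ _ h1, by simpa using h2.1, by simpa using h2.2⟩

theorem mem_treeProd {S₀ S₁ : Type*} (T₀ : Set (List S₀)) (V : Set (List S₁))
    (l : List (S₀ × S₁)) :
    l ∈ treeProd T₀ V ↔ ∃ y t, Dec T₀ l y t ∧ y ∈ V := by
  constructor
  · rintro ⟨k, s, x, hs, hm, hx, rfl⟩
    suffices ∃ t, Dec T₀ ((List.ofFn fun i => (s i).map fun a => (a, x i)).flatten)
        (List.ofFn x) t by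
      obtain ⟨t, ht⟩ := this
      exact ⟨_, t, ht, hx⟩
    clear hx
    induction k with
    | zero => exact ⟨s 0, by simpa using Dec.last (s 0) (x 0) (hs 0)⟩
    | succ k ih =>
      obtain ⟨t, ht⟩ := ih (fun i => s i.succ) (fun i => x i.succ) (fun i => hs _)
        (fun i hi => hm _ (by simpa using hi))
      refine ⟨t, ?_⟩
      rw [List.ofFn_succ, List.ofFn_succ (f := x), List.flatten_cons]
      exact Dec.cons _ _ (hm 0 (by simp)) _ _ _ ht
  · rintro ⟨y, t, h, hy⟩
    suffices ∃ (k : ℕ) (s : Fin (k + 1) → List S₀) (x : Fin (k + 1) → S₁),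
      (∀ i, s i ∈ T₀) ∧ (∀ i : Fin (k + 1), (i : ℕ) < k → s i ∈ MaxNodes T₀) ∧
      List.ofFn x = y ∧
      l = (List.ofFn fun i => (s i).map fun a => (a, x i)).flatten by
      obtain ⟨k, s, x, h1, h2, h3, h4⟩ := this
      exact ⟨k, s, x, h1, h2, h3 ▸ hy, h4⟩
    clear hy
    induction h with
    | last s x hs => exact ⟨0, fun _ => s, fun _ => x, fun _ => hs, by simp, by simp, by simp⟩
    | cons s x hs l y t h ih =>
      obtain ⟨k, s', x', h1, h2, h3, h4⟩ := ih
      refine ⟨k + 1, Fin.cons s s', Fin.cons x x', ?_, ?_, ?_, ?_⟩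
      · intro i
        refine Fin.cases ?_ (fun i => ?_) i
        · exact hs.1
        · exact h1 i
      · intro i
        refine Fin.cases ?_ (fun i => ?_) i
        · intro _; exact hs
        · intro hi; exact h2 i (by simpa using hi)
      · rw [List.ofFn_succ, ← h3]; rfl
      · rw [List.ofFn_succ]; simp [h4]

section iter
variable {S : Type*} (T : Set (List S))

theorem iter_zero : derivIter T 0 = T := by simp [derivIter]
theorem iter_succ (o : Ordinal.{0}) : derivIter T (o + 1) = treeDeriv (derivIter T o) := by
  unfold derivIter
  exact Ordinal.limitRecOn_add_one ..
theorem iter_limit (o : Ordinal.{0}) (h : Order.IsSuccLimit o) :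
    derivIter T o = ⋂ p : {p : Ordinal.{0} // p < o}, derivIter T p.1 := by
  unfold derivIter
  exact Ordinal.limitRecOn_limit _ _ _ _ h

theorem iter_anti {p o : Ordinal.{0}} (h : p ≤ o) : derivIter T o ⊆ derivIter T p := by
  induction o using Ordinal.limitRecOn with
  | zero => rw [nonpos_iff_eq_zero.1 h]
  | add_one o ih =>
    rcases h.eq_or_lt with rfl | h
    · exact subset_rfl
    · refine subset_trans ?_ (ih (Order.lt_succ_iff.1 h))
      erw [iter_succ]
      exact fun x hx => hx.1
  | limit o ho ih =>
    rcases h.eq_or_lt with rfl | h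
    · exact subset_rfl
    · rw [iter_limit T o ho]
      exact Set.iInter_subset_of_subset ⟨p, h⟩ subset_rfl

theorem iter_btree (hT : IsBTree T) (o : Ordinal.{0}) : IsBTree (derivIter T o) := by
  refine ⟨fun h => hT.1 (by rw [← iter_zero T]; exact iter_anti T bot_le h), ?_⟩
  induction o using Ordinal.limitRecOn with
  | zero => rw [iter_zero]; exact hT.2
  | add_one o ih =>
    erw [iter_succ]
    rintro s t ⟨ht, u, hu, htu⟩ hs hn
    refine ⟨ih s t ht hs hn, u, hu, hs.trans htu.1, ?_⟩
    rintro rfl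
    exact SPrefix.not_pre htu hs
  | limit o ho ih =>
    rw [iter_limit T o ho]
    intro s t ht hs hn
    simp only [Set.mem_iInter] at ht ⊢
    exact fun p => ih p.1 p.2 s t (ht p) hs hn

theorem iter_add (α β : Ordinal.{0}) :
    derivIter T (α + β) = derivIter (derivIter T α) β := by
  induction β using Ordinal.limitRecOn with
  | zero => rw [add_zero, iter_zero]
  | add_one o ih =>
    change derivIter T (α + (o + 1)) = derivIter _ (o + 1)
    rw [← add_assoc, iter_succ, iter_succ, ih]
  | limit o ho ih =>
    rw [iter_limit _ o ho, iter_limit _ _ (Ordinal.isSuccLimit_add α ho)]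
    ext x
    simp only [Set.mem_iInter]
    constructor
    · intro h p
      rw [← ih p.1 p.2]
      exact h ⟨α + p.1, by simpa using p.2⟩
    · rintro h ⟨p, hp⟩
      obtain ⟨q, hq, hpq⟩ := (Ordinal.lt_add_iff_of_isSuccLimit ho).1 hp
      have := h ⟨q, hq⟩
      rw [← ih q hq] at this
      exact iter_anti T hpq.le this

theorem order_spec (a : Ordinal.{0}) : treeOrder T = ↑a ↔
    derivIter T a = ∅ ∧ ∀ p < a, derivIter T p ≠ ∅ := by
  unfold treeOrder
  constructor
  · intro h
    split_ifs at h with he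
    · have h := WithTop.coe_injective h
      subst h
      exact ⟨csInf_mem he, fun p hp h => notMem_of_lt_csInf' hp h⟩
    · exact absurd h.symm (WithTop.coe_ne_top)
  · rintro ⟨h1, h2⟩
    rw [dif_pos ⟨a, h1⟩]
    congr 1
    refine le_antisymm (csInf_le' h1) ?_
    by_contra hlt
    exact h2 _ (not_le.1 hlt) (csInf_mem (⟨a, h1⟩ : {o | derivIter T o = ∅}.Nonempty))

theorem exists_max (hwf : WellFoundedTree T) {t : List S} (ht : t ∈ T) :
    ∃ m ∈ MaxNodes T, t <+: m := by
  by_contra hcon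
  have key : ∀ u : {u // u ∈ T ∧ t <+: u}, ∃ v : {u // u ∈ T ∧ t <+: u}, SPrefix u.1 v.1 := by
    rintro ⟨u, hu, htu⟩
    by_contra h
    refine hcon ⟨u, ⟨hu, ?_⟩, htu⟩
    rintro ⟨v, hv, huv⟩
    exact h ⟨⟨v, hv, htu.trans huv.1⟩, huv⟩
  choose f hf using key
  refine hwf ⟨fun n => (f^[n] ⟨t, ht, List.prefix_rfl⟩).1, fun n => (f^[n] ⟨t, ht, List.prefix_rfl⟩).2.1, ?_⟩
  intro n
  beta_reduce
  rw [Function.iterate_succ_apply']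
  exact hf _

end iter

theorem step {S₀ S₁ : Type*} (T₀ : Set (List S₀)) (V : Set (List S₁))
    (h₀ : IsBTree T₀) (hV : IsBTree V) (hwf₀ : WellFoundedTree T₀)
    (ζ : Ordinal.{0}) (hζ : ∀ p < ζ, derivIter T₀ p ≠ ∅) :
    derivIter (treeProd T₀ V) ζ =
      {l | ∃ y t, Dec T₀ l y t ∧ y ∈ V ∧ (t ∈ derivIter T₀ ζ ∨ y ∈ treeDeriv V)} := by
  induction ζ using Ordinal.limitRecOn with
  | zero =>
    rw [iter_zero, iter_zero]
    ext l
    rw [mem_treeProd]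
    constructor
    · rintro ⟨y, t, h, hy⟩
      exact ⟨y, t, h, hy, Or.inl h.mem⟩
    · rintro ⟨y, t, h, hy, -⟩
      exact ⟨y, t, h, hy⟩
  | add_one o ih =>
    change derivIter _ (o + 1) = {l | ∃ y t, Dec T₀ l y t ∧ y ∈ V ∧
      (t ∈ derivIter T₀ (o + 1) ∨ y ∈ treeDeriv V)}
    have hb := iter_btree T₀ h₀ o
    rw [iter_succ, iter_succ, ih (fun p hp => hζ p (hp.trans (Order.lt_succ o)))]
    ext l
    constructor
    · rintro ⟨⟨y, t, h, hy, -⟩, l', ⟨y', t', h', hy', hor⟩, hp⟩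
      refine ⟨y, t, h, hy, ?_⟩
      rcases h.sinv h₀.1 h' hp with ⟨rfl, hs⟩ | hs
      · rcases hor with hor | hor
        · left
          exact ⟨hb.2 _ _ hor hs.1 (fun e => h₀.1 (e ▸ h.mem)), t', hor, hs⟩
        · exact Or.inr hor
      · exact Or.inr ⟨hy, y', hy', hs⟩
    · rintro ⟨y, t, h, hy, hor⟩
      refine ⟨⟨y, t, h, hy, hor.imp (fun h => h.1) id⟩, ?_⟩
      rcases hor with ⟨ht, t', ht', hp⟩ | hW
      · obtain ⟨l', h1, h2⟩ := h.ext1 (by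
          rw [← iter_zero T₀]; exact iter_anti T₀ bot_le ht') hp
        exact ⟨l', ⟨y, t', h1, hy, Or.inl ht'⟩, h2⟩
      · obtain ⟨-, y', hy', ⟨z, rfl⟩, hne⟩ := hW
        cases z with
        | nil => simp at hne
        | cons x z =>
          obtain ⟨t', ht'⟩ := Set.nonempty_iff_ne_empty.2 (hζ o (Order.lt_succ o))
          obtain ⟨m, hm, htm⟩ := exists_max T₀ hwf₀ h.mem
          obtain ⟨l', h1, h2⟩ := h.ext2 h₀.1 hm htm (t' := t') (by
            rw [← iter_zero T₀]; exact iter_anti T₀ bot_le ht') x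
          exact ⟨l', ⟨_, t', h1, hV.2 _ _ hy' ⟨z, by simp⟩ (by simp), Or.inl ht'⟩, h2⟩
  | limit o ho ih =>
    rw [iter_limit _ o ho, iter_limit _ o ho]
    have ih' := fun p (hp : p < o) => ih p hp (fun q hq => hζ q (hq.trans hp))
    ext l
    simp only [Set.mem_iInter]
    constructor
    · intro hl
      have h2 := hl ⟨0, ho.bot_lt⟩
      rw [ih' 0 ho.bot_lt] at h2
      obtain ⟨y, t, h, hy, -⟩ := h2
      refine ⟨y, t, h, hy, ?_⟩
      by_contra hcon
      obtain ⟨hc1, hc2⟩ := not_or.1 hcon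
      apply hc1
      intro p
      have h3 := hl p
      rw [ih' p.1 p.2] at h3
      obtain ⟨y', t', h', hy', hor⟩ := h3
      obtain ⟨rfl, rfl⟩ := h.uniq h₀.1 h'
      exact hor.resolve_right hc2
    · rintro ⟨y, t, h, hy, hor⟩ p
      rw [ih' p.1 p.2]
      exact ⟨y, t, h, hy, hor.imp (fun h => h p) id⟩

end TP

/-- for nonempty well-founded B-trees, `[T₀,T₁]^{o(T₀)·ξ} = [T₀, T₁^ξ]`
and `o([T₀,T₁]) = o(T₀)·o(T₁)`. -/
theorem statement9 {S₀ S₁ : Type*} (T₀ : Set (List S₀)) (T₁ : Set (List S₁))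
    (h₀ : IsBTree T₀) (h₁ : IsBTree T₁) (hne₀ : T₀.Nonempty) (hne₁ : T₁.Nonempty)
    (hwf₀ : WellFoundedTree T₀) (hwf₁ : WellFoundedTree T₁)
    (a b : Ordinal.{0}) (ha : treeOrder T₀ = ↑a) (hb : treeOrder T₁ = ↑b) :
    (∀ ξ : Ordinal.{0},
      derivIter (treeProd T₀ T₁) (a * ξ) = treeProd T₀ (derivIter T₁ ξ)) ∧
    treeOrder (treeProd T₀ T₁) = ↑(a * b) := by
  obtain ⟨ha1, ha2⟩ := (TP.order_spec T₀ a).1 ha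
  obtain ⟨hb1, hb2⟩ := (TP.order_spec T₁ b).1 hb
  have ha0 : 0 < a := by
    rw [pos_iff_ne_zero]
    rintro rfl
    rw [TP.iter_zero] at ha1
    exact hne₀.ne_empty ha1
  have main : ∀ ξ : Ordinal.{0},
      derivIter (treeProd T₀ T₁) (a * ξ) = treeProd T₀ (derivIter T₁ ξ) := by
    intro ξ
    induction ξ using Ordinal.limitRecOn with
    | zero => rw [mul_zero, TP.iter_zero, TP.iter_zero]
    | add_one o ih =>
      change derivIter _ (a * (o + 1)) = treeProd T₀ (derivIter T₁ (o + 1))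
      rw [mul_add, mul_one, TP.iter_add, ih,
        TP.step T₀ _ h₀ (TP.iter_btree T₁ h₁ o) hwf₀ a ha2, ha1, TP.iter_succ]
      ext l
      rw [TP.mem_treeProd]
      constructor
      · rintro ⟨y, t, h, hy, hor⟩
        exact ⟨y, t, h, hor.resolve_left (by simp)⟩
      · rintro ⟨y, t, h, hy⟩
        exact ⟨y, t, h, hy.1, Or.inr hy⟩
    | limit o ho ih =>
      rw [TP.iter_limit _ o ho, TP.iter_limit _ _ (Ordinal.isSuccLimit_mul_right ha0 ho)]
      ext l
      rw [TP.mem_treeProd]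
      simp only [Set.mem_iInter]
      constructor
      · intro hl
        have key : ∀ p < o, ∃ y t, TP.Dec T₀ l y t ∧ y ∈ derivIter T₁ p := by
          intro p hp
          rw [← TP.mem_treeProd, ← ih p hp]
          exact hl ⟨a * p, (mul_lt_mul_iff_right₀ ha0).2 hp⟩
        obtain ⟨y, t, h, -⟩ := key 0 ho.bot_lt
        refine ⟨y, t, h, fun p => ?_⟩
        obtain ⟨y', t', h', hy⟩ := key p.1 p.2
        obtain ⟨rfl, rfl⟩ := h.uniq h₀.1 h'
        exact hy
      · rintro ⟨y, t, h, hy⟩ ⟨p, hp⟩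
        obtain ⟨q, hq, hpq⟩ := (Ordinal.lt_mul_iff_of_isSuccLimit ho).1 hp
        refine TP.iter_anti _ hpq.le ?_
        rw [ih q hq, TP.mem_treeProd]
        exact ⟨y, t, h, hy ⟨q, hq⟩⟩
  refine ⟨main, (TP.order_spec _ _).2 ⟨?_, ?_⟩⟩
  · rw [main, hb1]
    ext l
    simp [TP.mem_treeProd]
  · intro p hp
    have hlt : p / a < b := (Ordinal.lt_mul_iff_div_lt ha0.ne').1 hp
    have hV := TP.iter_btree T₁ h₁ (p / a)
    have hmod := Ordinal.mod_lt p ha0.ne'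
    rw [← Ordinal.div_add_mod p a, TP.iter_add, main,
      TP.step T₀ _ h₀ hV hwf₀ _ (fun q hq => ha2 q (hq.trans hmod))]
    obtain ⟨y, hy⟩ := Set.nonempty_iff_ne_empty.2 (hb2 _ hlt)
    obtain ⟨t, ht⟩ := Set.nonempty_iff_ne_empty.2 (ha2 _ hmod)
    apply Set.Nonempty.ne_empty
    cases y with
    | nil => exact absurd hy hV.1
    | cons x y =>
      refine ⟨_, [x], t, TP.Dec.last t x ?_, hV.2 _ _ hy ⟨y, by simp⟩ (by simp), Or.inl ht⟩
      rw [← TP.iter_zero T₀]; exact TP.iter_anti T₀ bot_le ht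
end
end

section
/- For all nonzero ordinals ξ and ζ, there exist monotone maps θ₁ : [𝒯_ξ, 𝒯_ζ] → 𝒯_{ξζ} and θ₂ : 𝒯_{ξζ} → [𝒯_ξ, 𝒯_ζ], where ξζ is the ordinal product. -/
noncomputable section
open Ordinal

def DD (o : Ordinal.{0}) : Set (List Ordinal.{0}) :=
  { l | l ≠ [] ∧ l.Pairwise (· > ·) ∧ ∀ a ∈ l, a < o }

def prd : Ordinal.{0} → Ordinal.{0} := Function.invFun (fun a => a + 1)

theorem prd_add_one (a : Ordinal.{0}) : prd (a + 1) = a :=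
  Function.leftInverse_invFun (f := fun a : Ordinal.{0} => a + 1)
    (fun a b h => by simpa using h) a

theorem calT_zero : calT 0 = ∅ := by
  unfold calT; exact Ordinal.limitRecOn_zero ..

theorem calT_succ (o : Ordinal.{0}) :
    calT (o + 1) = {[o + 1]} ∪ (List.cons (o + 1)) '' calT o := by
  unfold calT; exact Ordinal.limitRecOn_add_one ..

theorem calT_limit (o : Ordinal.{0}) (h : Order.IsSuccLimit o) :
    calT o = ⋃ p : {p : Ordinal.{0} // p < o}, calT p.1 := by
  unfold calT; exact Ordinal.limitRecOn_limit _ _ _ _ h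

theorem calT_sub (ξ : Ordinal.{0}) : ∀ t ∈ calT ξ, t.map prd ∈ DD ξ := by
  induction ξ using Ordinal.limitRecOn with
  | zero => intro t ht; rw [calT_zero] at ht; exact ht.elim
  | add_one o ih =>
    intro t ht
    rw [calT_succ] at ht
    rcases ht with rfl | ⟨u, hu, rfl⟩
    · simp [DD, prd_add_one]
    · obtain ⟨h1, h2, h3⟩ := ih u hu
      refine ⟨by simp, ?_, ?_⟩
      · rw [List.map_cons, List.pairwise_cons, prd_add_one]
        exact ⟨h3, h2⟩
      · intro a ha
        rw [List.map_cons, List.mem_cons, prd_add_one] at ha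
        rcases ha with rfl | ha
        · simp
        · exact (h3 a ha).trans (by simp)
  | limit o ho ih =>
    intro t ht
    rw [calT_limit o ho] at ht
    obtain ⟨⟨p, hp⟩, hpt⟩ := Set.mem_iUnion.1 ht
    obtain ⟨h1, h2, h3⟩ := ih p hp t hpt
    exact ⟨h1, h2, fun a ha => (h3 a ha).trans hp⟩

theorem sprefix_iff {S : Type*} (s t : List S) : SPrefix s t ↔ ∃ w, w ≠ [] ∧ t = s ++ w := by
  constructor
  · rintro ⟨⟨w, rfl⟩, h⟩
    exact ⟨w, fun hw => h (by simp [hw]), rfl⟩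
  · rintro ⟨w, hw, rfl⟩
    exact ⟨⟨w, rfl⟩, fun h => hw (by simpa using h)⟩

theorem limit_step {S : Type*} (o : Ordinal.{0}) (g : Ordinal.{0} → Ordinal.{0})
    (V : Ordinal.{0} → Set (List S)) (hV : ∀ p < o, V p ⊆ V o)
    (hg : ∀ a < g o, ∃ p < o, a < g p)
    (ih : ∀ p < o, ∃ φ : List Ordinal.{0} → List S, φ [] = [] ∧ MonotoneTreeMap φ (DD (g p)) (V p)) :
    ∃ φ : List Ordinal.{0} → List S, φ [] = [] ∧ MonotoneTreeMap φ (DD (g o)) (V o) := by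
  classical
  choose! q hq1 hq2 using hg
  choose! Φ h0 hm using ih
  have key : ∀ c r, c :: r ∈ DD (g o) → c :: r ∈ DD (g (q c)) := by
    rintro c r ⟨h1, h2, h3⟩
    have hc := hq2 c (h3 c (by simp))
    refine ⟨h1, h2, ?_⟩
    intro a ha
    rcases List.mem_cons.1 ha with rfl | ha
    · exact hc
    · exact lt_trans ((List.pairwise_cons.1 h2).1 a ha) hc
  refine ⟨fun l => match l with | [] => [] | c :: r => Φ (q c) (c :: r), rfl, ?_, ?_⟩
  · intro l hl
    cases l with
    | nil => exact (hl.1 rfl).elim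
    | cons c r =>
      have := hq1 c (hl.2.2 c (by simp))
      exact hV _ this ((hm _ this).1 (key c r hl))
  · intro s hs t ht hst
    cases s with
    | nil => exact (hs.1 rfl).elim
    | cons c r =>
      obtain ⟨w, hw, rfl⟩ := (sprefix_iff _ _).1 hst
      have := hq1 c (hs.2.2 c (by simp))
      exact (hm _ this).2 _ (key c r hs) _ (key c (r ++ w) ht) hst

theorem calT_mono_limit (o : Ordinal.{0}) (ho : Order.IsSuccLimit o) : ∀ p < o, calT p ⊆ calT o := by
  intro p hp
  rw [calT_limit o ho]
  exact Set.subset_iUnion (fun p : {p : Ordinal.{0} // p < o} => calT p.1) ⟨p, hp⟩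

theorem exists_phi (ξ : Ordinal.{0}) : ∃ φ : List Ordinal.{0} → List Ordinal.{0},
    φ [] = [] ∧ MonotoneTreeMap φ (DD ξ) (calT ξ) := by
  induction ξ using Ordinal.limitRecOn with
  | zero =>
    have : ∀ l ∈ DD 0, False := by
      rintro l ⟨h1, -, h3⟩
      cases l with
      | nil => exact h1 rfl
      | cons a l => exact absurd (h3 a (by simp)) (by simp)
    exact ⟨fun _ => [], rfl, fun l hl => (this l hl).elim, fun l hl => (this l hl).elim⟩
  | add_one o ih =>
    obtain ⟨φ, h0, h1, h2⟩ := ih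
    have key : ∀ c r, c :: r ∈ DD (o + 1) → r ≠ [] → r ∈ DD o := by
      rintro c r ⟨_, h2, h3⟩ hr
      refine ⟨hr, (List.pairwise_cons.1 h2).2, fun a ha => ?_⟩
      exact lt_of_lt_of_le ((List.pairwise_cons.1 h2).1 a ha) (Order.lt_add_one_iff.1 (h3 c (by simp)))
    refine ⟨fun l => match l with | [] => [] | c :: r => (o + 1) :: φ r, rfl, ?_, ?_⟩
    · intro l hl
      rw [calT_succ]
      cases l with
      | nil => exact (hl.1 rfl).elim
      | cons c r =>
        by_cases hr : r = []
        · subst hr; left; simp [h0]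
        · right; exact ⟨_, h1 (key c r hl hr), rfl⟩
    · intro s hs t ht hst
      cases s with
      | nil => exact (hs.1 rfl).elim
      | cons c r =>
        obtain ⟨w, hw, rfl⟩ := (sprefix_iff _ _).1 hst
        have hk := key c (r ++ w) ht (by simp [hw])
        by_cases hr : r = []
        · subst hr
          have := (calT_sub o _ (h1 hk)).1
          rw [sprefix_iff]
          exact ⟨φ ([] ++ w), by simpa using this, by simp [h0]⟩
        · have := h2 _ (key c r hs hr) _ hk ((sprefix_iff _ _).2 ⟨w, hw, rfl⟩)
          obtain ⟨v, hv, he⟩ := (sprefix_iff _ _).1 this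
          exact (sprefix_iff _ _).2 ⟨v, hv, by simp [he]⟩
  | limit o ho ih =>
    exact limit_step o id calT (calT_mono_limit o ho)
      (fun a ha => ⟨a + 1, ho.add_one_lt ha, by simp⟩) ih

theorem calT_nonempty (ξ : Ordinal.{0}) (hξ : ξ ≠ 0) : ∃ t, t ∈ calT ξ := by
  obtain ⟨φ, -, h, -⟩ := exists_phi ξ
  exact ⟨φ [0], h ⟨by simp, by simp, by simpa [pos_iff_ne_zero] using hξ⟩⟩

theorem exists_max (ξ : Ordinal.{0}) (hξ : ξ ≠ 0) (t : List Ordinal.{0})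
    (ht : t = [] ∨ t ∈ calT ξ) : ∃ m ∈ MaxNodes (calT ξ), t <+: m := by
  have hne : ∃ u, u ∈ calT ξ ∧ t <+: u := by
    rcases ht with rfl | ht
    · obtain ⟨u, hu⟩ := calT_nonempty ξ hξ
      exact ⟨u, hu, by simp⟩
    · exact ⟨t, ht, by simp⟩
  obtain ⟨m, ⟨hm, htm⟩, hmin⟩ := WellFounded.has_min
    (InvImage.wf (fun l : List Ordinal.{0} => (l.map prd).getLastD 0) Ordinal.lt_wf)
    {u | u ∈ calT ξ ∧ t <+: u} hne
  refine ⟨m, ⟨hm, ?_⟩, htm⟩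
  rintro ⟨u, hu, hmu⟩
  refine hmin u ⟨hu, htm.trans hmu.1⟩ ?_
  obtain ⟨w, hw, rfl⟩ := (sprefix_iff _ _).1 hmu
  obtain ⟨-, h2, -⟩ := calT_sub _ _ hu
  have h1 := (calT_sub _ _ hm).1
  have hw' : w.map prd ≠ [] := by simpa using hw
  rw [List.map_append] at h2
  simp only [InvImage, List.map_append]
  rw [List.getLastD_eq_getLast?, List.getLastD_eq_getLast?, List.getLast?_append_of_ne_nil _ hw',
    List.getLast?_eq_getLast_of_ne_nil hw', List.getLast?_eq_getLast_of_ne_nil h1]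
  exact (List.pairwise_append.1 h2).2.2 _ (List.getLast_mem h1) _ (List.getLast_mem hw')

theorem treeProd_single (T₀ : Set (List Ordinal.{0})) (η : Ordinal.{0}) (p : List Ordinal.{0})
    (hp : p ∈ T₀) : p.map (fun a => (a, η + 1)) ∈ treeProd T₀ (calT (η + 1)) := by
  refine ⟨0, fun _ => p, fun _ => η + 1, fun _ => hp, fun i hi => by omega, ?_, by simp⟩
  rw [calT_succ]; left; simp

theorem treeProd_cons (T₀ : Set (List Ordinal.{0})) (η : Ordinal.{0}) (p : List Ordinal.{0})
    (hp : p ∈ MaxNodes T₀) (l : List (Ordinal.{0} × Ordinal.{0})) (hl : l ∈ treeProd T₀ (calT η)) :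
    p.map (fun a => (a, η + 1)) ++ l ∈ treeProd T₀ (calT (η + 1)) := by
  obtain ⟨k, s, x, h1, h2, h3, rfl⟩ := hl
  refine ⟨k + 1, Fin.cons p s, Fin.cons (η + 1) x, ?_, ?_, ?_, ?_⟩
  · intro i
    refine Fin.cases ?_ (fun j => ?_) i
    · exact hp.1
    · simpa using h1 j
  · intro i
    refine Fin.cases ?_ (fun j => ?_) i
    · intro _; exact hp
    · intro hj; simpa using h2 j (by simpa using hj)
  · rw [calT_succ]; right
    exact ⟨_, h3, by simp [List.ofFn_succ]⟩
  · rw [List.ofFn_succ (n := k + 1)]; simp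

theorem treeProd_mono (T₀ : Set (List Ordinal.{0})) {A B : Set (List Ordinal.{0})} (h : A ⊆ B) :
    treeProd T₀ A ⊆ treeProd T₀ B := by
  rintro l ⟨k, s, x, h1, h2, h3, h4⟩
  exact ⟨k, s, x, h1, h2, h h3, h4⟩

theorem treeProd_ne_nil (ξ : Ordinal.{0}) (B : Set (List Ordinal.{0})) :
    ∀ l ∈ treeProd (calT ξ) B, l ≠ [] := by
  rintro l ⟨k, s, x, h1, h2, h3, rfl⟩ h
  have := (calT_sub _ _ (h1 0)).1
  rw [List.ofFn_succ] at h
  simp at h this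
  exact this h.1

theorem theta_one (ξ ζ : Ordinal.{0}) (l : List (Ordinal.{0} × Ordinal.{0}))
    (hl : l ∈ treeProd (calT ξ) (calT ζ)) :
    l.map (fun p => ξ * prd p.2 + prd p.1) ∈ DD (ξ * ζ) := by
  have hne := treeProd_ne_nil _ _ l hl
  obtain ⟨k, s, x, h1, h2, h3, rfl⟩ := hl
  obtain ⟨-, hx2, hx3⟩ := calT_sub _ _ h3
  rw [List.map_ofFn, List.pairwise_ofFn] at hx2
  have hx3' : ∀ i, prd (x i) < ζ := fun i =>
    hx3 _ (List.mem_map_of_mem ((List.mem_ofFn' _ _).2 ⟨i, rfl⟩))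
  have hs : ∀ i, ∀ a ∈ s i, prd a < ξ := fun i a ha =>
    (calT_sub _ _ (h1 i)).2.2 _ (List.mem_map_of_mem ha)
  have hlt : ∀ {a x y : Ordinal.{0}}, a < ξ → x < y → ξ * x + a < ξ * y := by
    intro a x y ha hxy
    calc ξ * x + a < ξ * x + ξ := by simpa using ha
      _ = ξ * (x + 1) := by rw [mul_add, mul_one]
      _ ≤ ξ * y := by gcongr; exact Order.add_one_le_of_lt hxy
  refine ⟨by simpa using hne, ?_, ?_⟩
  · rw [List.pairwise_map, List.pairwise_flatten]
    constructor
    · intro l hl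
      obtain ⟨i, rfl⟩ := (List.mem_ofFn' _ _).1 hl
      rw [List.pairwise_map]
      have := (calT_sub _ _ (h1 i)).2.1
      rw [List.pairwise_map] at this
      exact this.imp (fun h => by simpa using h)
    · rw [List.pairwise_ofFn]
      intro i j hij a ha b hb
      obtain ⟨a', ha', rfl⟩ := List.mem_map.1 ha
      obtain ⟨b', hb', rfl⟩ := List.mem_map.1 hb
      exact (hlt (hs j b' hb') (hx2 hij)).trans_le (le_self_add)
  · intro c hc
    obtain ⟨p, hp, rfl⟩ := List.mem_map.1 hc
    obtain ⟨l, hl, hp⟩ := List.mem_flatten.1 hp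
    obtain ⟨i, rfl⟩ := (List.mem_ofFn' _ _).1 hl
    obtain ⟨a, ha, rfl⟩ := List.mem_map.1 hp
    exact hlt (hs i a ha) (hx3' i)

/-- splitting a decreasing list. -/
theorem split_DD (ξ η : Ordinal.{0}) (l : List Ordinal.{0}) (hl : l.Pairwise (· > ·)) :
    l = l.filter (fun a => ξ * η ≤ a) ++ l.filter (fun a => a < ξ * η) := by
  induction l with
  | nil => rfl
  | cons c r ih =>
    obtain ⟨h1, h2⟩ := List.pairwise_cons.1 hl
    by_cases hc : ξ * η ≤ c
    · have : ¬ c < ξ * η := not_lt.2 hc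
      simp only [List.filter_cons, hc, this, decide_true, decide_false, if_true]
      simpa using ih h2
    · have hc' : c < ξ * η := not_le.1 hc
      have e1 : r.filter (fun a => ξ * η ≤ a) = [] := by
        rw [List.filter_eq_nil_iff]
        intro a ha; simpa using (h1 a ha).trans hc'
      have := ih h2
      rw [e1, List.nil_append] at this
      simp [List.filter_cons, hc, hc', e1, ← this]

theorem exists_psi (ξ : Ordinal.{0}) (hξ : ξ ≠ 0) (ζ : Ordinal.{0}) :
    ∃ ψ : List Ordinal.{0} → List (Ordinal.{0} × Ordinal.{0}),
      ψ [] = [] ∧ MonotoneTreeMap ψ (DD (ξ * ζ)) (treeProd (calT ξ) (calT ζ)) := by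
  classical
  induction ζ using Ordinal.limitRecOn with
  | zero =>
    have : ∀ l ∈ DD (ξ * 0), False := by
      rintro l ⟨h1, -, h3⟩
      cases l with
      | nil => exact h1 rfl
      | cons a l => exact absurd (h3 a (by simp)) (by simp)
    exact ⟨fun _ => [], rfl, fun l hl => (this l hl).elim, fun l hl => (this l hl).elim⟩
  | limit o ho ih =>
    refine limit_step o (fun p => ξ * p) (fun p => treeProd (calT ξ) (calT p))
      (fun p hp => treeProd_mono _ (calT_mono_limit o ho p hp)) (fun a ha => ?_) ih
    exact (Ordinal.lt_mul_iff_of_isSuccLimit ho).1 ha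
  | add_one η ih =>
    obtain ⟨ψ, h0, h1, h2⟩ := ih
    obtain ⟨φ, f0, f1, f2⟩ := exists_phi ξ
    have hmax := exists_max ξ hξ
    choose! m hm1 hm2 using hmax
    let U : List Ordinal.{0} → List Ordinal.{0} := fun l =>
      (l.filter (fun a => ξ * η ≤ a)).map (fun a => a - ξ * η)
    let V : List Ordinal.{0} → List Ordinal.{0} := fun l => l.filter (fun a => a < ξ * η)
    have hU : ∀ l ∈ DD (ξ * (η + 1)), U l ≠ [] → U l ∈ DD ξ := by
      rintro l ⟨-, l2, l3⟩ hne
      refine ⟨hne, ?_, ?_⟩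
      · rw [List.pairwise_map]
        refine (l2.filter _).imp_of_mem ?_
        intro a b ha hb hab
        have ha := (List.mem_filter.1 ha).2
        have hb := (List.mem_filter.1 hb).2
        simp only [decide_eq_true_eq] at ha hb
        rw [gt_iff_lt, ← add_lt_add_iff_left (ξ * η), Ordinal.add_sub_cancel_of_le ha,
          Ordinal.add_sub_cancel_of_le hb]
        exact hab
      · intro c hc
        obtain ⟨a, ha, rfl⟩ := List.mem_map.1 hc
        obtain ⟨hal, ha⟩ := List.mem_filter.1 ha
        simp only [decide_eq_true_eq] at ha
        rw [← add_lt_add_iff_left (ξ * η), Ordinal.add_sub_cancel_of_le ha]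
        simpa [mul_add] using l3 a hal
    have hφU : ∀ l ∈ DD (ξ * (η + 1)), φ (U l) = [] ∨ φ (U l) ∈ calT ξ := by
      intro l hl
      by_cases h : U l = []
      · left; rw [h, f0]
      · right; exact f1 (hU l hl h)
    have hVD : ∀ l ∈ DD (ξ * (η + 1)), V l ≠ [] → V l ∈ DD (ξ * η) := by
      rintro l ⟨-, l2, l3⟩ hne
      exact ⟨hne, l2.filter _, fun a ha => by simpa using (List.mem_filter.1 ha).2⟩
    have hUV : ∀ l ∈ DD (ξ * (η + 1)), V l = [] → U l ≠ [] := by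
      rintro l ⟨l1, l2, -⟩ hv hu
      have := split_DD ξ η l l2
      simp only [U, V, List.map_eq_nil_iff] at hv hu
      rw [hv, hu] at this
      exact l1 this
    let P : List Ordinal.{0} → List (Ordinal.{0} × Ordinal.{0}) := fun p => p.map (fun a => (a, η + 1))
    have hne : ∀ l ∈ DD (ξ * (η + 1)), V l ≠ [] → ψ (V l) ≠ [] := fun l hl hv =>
      treeProd_ne_nil _ _ _ (h1 (hVD l hl hv))
    refine ⟨fun l => if V l = [] then P (φ (U l)) else P (m (φ (U l))) ++ ψ (V l), ?_, ?_, ?_⟩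
    · simp [U, V, P, f0]
    · intro l hl
      dsimp only
      split_ifs with hv
      · exact treeProd_single _ _ _ (f1 (hU l hl (hUV l hl hv)))
      · exact treeProd_cons _ _ _ (hm1 _ (hφU l hl)) _ (h1 (hVD l hl hv))
    · intro s hs t ht hst
      obtain ⟨w, hw, rfl⟩ := (sprefix_iff _ _).1 hst
      have eU : U (s ++ w) = U s ++ U w := by simp [U]
      have eV : V (s ++ w) = V s ++ V w := by simp [V]
      dsimp only
      by_cases hv : V s = []
      · rw [if_pos hv]
        have hus := hUV s hs hv
        have hus' : U (s ++ w) ≠ [] := by rw [eU]; simp [hus]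
        by_cases huw : U w = []
        · have hvw : V w ≠ [] := by
            intro h
            have := split_DD ξ η w (List.pairwise_append.1 ht.2.1).2.1
            simp only [U, V, List.map_eq_nil_iff] at huw h
            rw [huw, h] at this
            exact hw this
          have hv' : V (s ++ w) ≠ [] := by rw [eV]; simp [hvw]
          rw [if_neg hv', sprefix_iff]
          obtain ⟨z, hz⟩ := hm2 _ (hφU _ ht)
          refine ⟨P z ++ ψ (V (s ++ w)), by simp [hne _ ht hv'], ?_⟩
          rw [← hz, eU, huw, List.append_nil]
          simp [P]
        · have hp := f2 _ (hU s hs hus) _ (hU _ ht hus') ((sprefix_iff _ _).2 ⟨U w, huw, eU⟩)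
          obtain ⟨y, hy, hy'⟩ := (sprefix_iff _ _).1 hp
          split_ifs with hv'
          · rw [sprefix_iff]
            exact ⟨P y, by simpa [P] using hy, by rw [hy']; simp [P]⟩
          · obtain ⟨z, hz⟩ := hm2 _ (hφU _ ht)
            rw [sprefix_iff]
            refine ⟨P y ++ P z ++ ψ (V (s ++ w)), by simp [hne _ ht hv'], ?_⟩
            rw [← hz, hy']; simp [P]
      · have hv' : V (s ++ w) ≠ [] := by rw [eV]; simp [hv]
        have huw : U w = [] := by
          obtain ⟨a, r, har⟩ := List.exists_cons_of_ne_nil hv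
          have ha : a ∈ V s := by rw [har]; simp
          obtain ⟨has, ha⟩ := List.mem_filter.1 ha
          simp only [U, List.map_eq_nil_iff, List.filter_eq_nil_iff]
          intro b hb
          have := (List.pairwise_append.1 ht.2.1).2.2 a has b hb
          simp only [decide_eq_true_eq] at ha ⊢
          exact not_le.2 (lt_trans this ha)
        have hvw : V w ≠ [] := by
          intro h
          have := split_DD ξ η w (List.pairwise_append.1 ht.2.1).2.1
          simp only [U, V, List.map_eq_nil_iff] at huw h
          rw [huw, h] at this
          exact hw this
        rw [if_neg hv, if_neg hv', eU, huw, List.append_nil]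
        have := h2 _ (hVD s hs hv) _ (hVD _ ht hv') ((sprefix_iff _ _).2 ⟨V w, hvw, eV⟩)
        obtain ⟨y, hy, hy'⟩ := (sprefix_iff _ _).1 this
        exact (sprefix_iff _ _).2 ⟨y, hy, by rw [hy', List.append_assoc]⟩

theorem map_sprefix {S S' : Type*} (f : S → S') {s t : List S} (h : SPrefix s t) :
    SPrefix (s.map f) (t.map f) := by
  obtain ⟨w, hw, rfl⟩ := (sprefix_iff _ _).1 h
  exact (sprefix_iff _ _).2 ⟨w.map f, by simpa using hw, by simp⟩

/-- for nonzero ordinals `ξ, ζ` there are monotone maps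
`θ₁ : [𝒯_ξ, 𝒯_ζ] → 𝒯_{ξζ}` and `θ₂ : 𝒯_{ξζ} → [𝒯_ξ, 𝒯_ζ]`. -/
theorem statement10 (ξ ζ : Ordinal.{0}) (hξ : ξ ≠ 0) (hζ : ζ ≠ 0) :
    (∃ θ₁ : List (Ordinal.{0} × Ordinal.{0}) → List Ordinal.{0},
      MonotoneTreeMap θ₁ (treeProd (calT ξ) (calT ζ)) (calT (ξ * ζ))) ∧
    (∃ θ₂ : List Ordinal.{0} → List (Ordinal.{0} × Ordinal.{0}),
      MonotoneTreeMap θ₂ (calT (ξ * ζ)) (treeProd (calT ξ) (calT ζ))) := by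
  constructor
  · obtain ⟨φ, -, h1, h2⟩ := exists_phi (ξ * ζ)
    exact ⟨fun l => φ (l.map (fun p => ξ * prd p.2 + prd p.1)),
      fun l hl => h1 (theta_one ξ ζ l hl), fun s hs t ht hst =>
        h2 _ (theta_one ξ ζ s hs) _ (theta_one ξ ζ t ht) (map_sprefix _ hst)⟩
  · obtain ⟨ψ, -, h1, h2⟩ := exists_psi ξ hξ ζ
    exact ⟨fun l => ψ (l.map prd), fun l hl => h1 (calT_sub _ l hl), fun s hs t ht hst =>
        h2 _ (calT_sub _ s hs) _ (calT_sub _ t ht) (map_sprefix _ hst)⟩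
end
end

section
/- Let ξ be an ordinal, T a B-tree with o(T) ≥ ω^{ω^ξ}, S a finite set, and f : Λ(T) → S any function. Then there exist a B-tree T₀ with o(T₀) = ω^{ω^ξ}, a monotone map θ : T₀ → T, and x ∈ S such that f(θ(s), θ(t)) = x for all (s,t) ∈ Λ(T₀). -/
noncomputable section
open Ordinal

universe u v
namespace T13
open Classical

def Big {X : Type u} (r : X → X → Prop) (α : Ordinal.{0}) (Z : Set X) : Prop :=
  ∀ β, (_ : β < α) → ∃ y ∈ Z, Big r β {u | u ∈ Z ∧ r y u}
termination_by α

theorem big_iff {X : Type u} {r : X → X → Prop} {α : Ordinal.{0}} {Z : Set X} :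
    Big r α Z ↔ ∀ β, β < α → ∃ y ∈ Z, Big r β {u | u ∈ Z ∧ r y u} := by
  rw [Big]

theorem Big.mono {X : Type u} {r : X → X → Prop} {α : Ordinal.{0}} :
    ∀ {β : Ordinal.{0}} {Z Z' : Set X}, Big r α Z → β ≤ α → Z ⊆ Z' → Big r β Z' := by
  induction α using WellFoundedLT.induction with
  | ind α ih =>
    intro β Z Z' h hb hZ
    rw [big_iff] at h ⊢
    intro ε hε
    obtain ⟨y, hy, h2⟩ := h ε (hε.trans_le hb)
    exact ⟨y, hZ hy, ih ε (hε.trans_le hb) h2 le_rfl (fun u hu => ⟨hZ hu.1, hu.2⟩)⟩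

theorem big_zero {X : Type u} {r : X → X → Prop} {Z : Set X} : Big r 0 Z := by
  rw [big_iff]; intro β hβ; exact absurd hβ not_lt_zero

/-- rank with an invariant -/
def Rk {σ : Type v} (s : σ → σ → Prop) (Φ : σ → Prop) (b : Ordinal.{0}) (x : σ) : Prop :=
  Φ x ∧ ∀ β, (_ : β < b) → ∃ x', s x x' ∧ Rk s Φ β x'
termination_by b

theorem rk_iff {σ : Type v} {s : σ → σ → Prop} {Φ : σ → Prop} {b : Ordinal.{0}} {x : σ} :
    Rk s Φ b x ↔ Φ x ∧ ∀ β, β < b → ∃ x', s x x' ∧ Rk s Φ β x' := by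
  rw [Rk]

theorem Rk.mono {σ : Type v} {s : σ → σ → Prop} {Φ : σ → Prop} {b b' : Ordinal.{0}} {x : σ}
    (h : Rk s Φ b x) (hb : b' ≤ b) : Rk s Φ b' x := by
  rw [rk_iff] at h ⊢
  exact ⟨h.1, fun β hβ => h.2 β (hβ.trans_le hb)⟩

theorem Rk.inv {σ : Type v} {s : σ → σ → Prop} {Φ : σ → Prop} {b : Ordinal.{0}} {x : σ}
    (h : Rk s Φ b x) : Φ x := by
  rw [rk_iff] at h
  exact h.1

theorem rk_of_succ {σ : Type v} {s : σ → σ → Prop} {Φ : σ → Prop} {b : Ordinal.{0}} {x : σ}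
    (hx : Φ x) (h : ∀ β, β < b → Rk s Φ (β + 1) x) : Rk s Φ b x := by
  rw [rk_iff]
  refine ⟨hx, fun β hβ => ?_⟩
  have := h β hβ
  rw [rk_iff] at this
  exact this.2 β (Order.lt_add_one_iff.2 le_rfl)

theorem rk_succ {σ : Type v} {s : σ → σ → Prop} {Φ : σ → Prop} {b : Ordinal.{0}} {x y : σ}
    (hx : Φ x) (hs : s x y) (h : Rk s Φ b y) : Rk s Φ (b + 1) x := by
  rw [rk_iff]
  exact ⟨hx, fun β hβ => ⟨y, hs, h.mono (Order.lt_add_one_iff.1 hβ)⟩⟩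

theorem pigeon {V : Type*} [Finite V] [Nonempty V] {b : Ordinal.{0}} (Φ : V → Ordinal.{0} → Prop)
    (anti : ∀ v β β', β ≤ β' → Φ v β' → Φ v β) (h : ∀ β, β < b → ∃ v, Φ v β) :
    ∃ v, ∀ β, β < b → Φ v β := by
  by_contra hc
  push Not at hc
  choose B hB hB' using hc
  obtain ⟨v0, hv0⟩ := Finite.exists_max B
  obtain ⟨v, hv⟩ := h (B v0) (hB v0)
  exact hB' v (anti _ _ _ (hv0 v) hv)

section N
variable {C : Type} [Fintype C]

theorem wfC : WellFounded (fun a b : C → Ordinal.{0} => a < b) := wellFounded_lt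

def N : (C → Ordinal.{0}) → Ordinal.{0} :=
  WellFounded.fix (wfC (C := C)) (fun γ ih => ⨆ x : (Σ c : C, Set.Iio (γ c)),
    ih (Function.update γ x.1 x.2.1) (update_lt_self_iff.2 x.2.2) + 1)

theorem N_eq (γ : C → Ordinal.{0}) :
    N γ = ⨆ x : (Σ c : C, Set.Iio (γ c)), (N (Function.update γ x.1 x.2.1) + 1) := by
  rw [N, WellFounded.fix_eq]

theorem N_lt (γ : C → Ordinal.{0}) (c : C) (δ : Ordinal.{0}) (h : δ < γ c) :
    N (Function.update γ c δ) < N γ := by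
  rw [N_eq γ, ← Order.add_one_le_iff]
  exact Ordinal.le_iSup (fun x : (Σ c : C, Set.Iio (γ c)) => N (Function.update γ x.1 x.2.1) + 1)
    ⟨c, δ, h⟩

theorem N_le (γ : C → Ordinal.{0}) (α : Ordinal.{0})
    (h : ∀ c δ, δ < γ c → N (Function.update γ c δ) < α) : N γ ≤ α := by
  rw [N_eq γ]
  apply Ordinal.iSup_le
  rintro ⟨c, δ, hδ⟩
  exact Order.add_one_le_iff.2 (h c δ hδ)

theorem N_mul_add (e : Ordinal.{0}) (he : ∀ γ : C → Ordinal.{0}, (∀ c, γ c < ω ^ e) → N γ < ω ^ e) :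
    ∀ (γ : C → Ordinal.{0}) (n : C → ℕ) (a : C → Ordinal.{0}),
      (∀ c, a c < ω ^ e) → (∀ c, γ c = ω ^ e * (n c : Ordinal) + a c) →
      N γ ≤ ω ^ e * ((∑ c, n c : ℕ) : Ordinal) + N a := by
  have hpos : (0 : Ordinal) < ω ^ e := Ordinal.opow_pos _ Ordinal.omega0_pos
  intro γ
  induction γ using (wfC (C := C)).induction with
  | _ γ ih =>
    intro n a ha hγ
    apply N_le
    intro c δ hδ
    -- decompose δ
    set a' := δ % ω ^ e with ha'
    have hdecomp : ω ^ e * (δ / ω ^ e) + a' = δ := Ordinal.div_add_mod _ _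
    have ha'lt : a' < ω ^ e := Ordinal.mod_lt _ hpos.ne'
    have hq : δ / ω ^ e < (n c + 1 : ℕ) := by
      rw [← Ordinal.lt_mul_iff_div_lt hpos.ne']
      refine hδ.trans ?_
      rw [hγ c, Nat.cast_add, Nat.cast_one, mul_add, mul_one]
      exact (add_lt_add_iff_left _).2 (ha c)
    obtain ⟨n', hn'⟩ := Ordinal.lt_omega0.1 (hq.trans (Ordinal.natCast_lt_omega0 _))
    rw [hn'] at hdecomp hq
    have hq' : n' ≤ n c := by
      have : n' < n c + 1 := by exact_mod_cast hq
      omega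
    have hlt : Function.update γ c δ < γ := update_lt_self_iff.2 hδ
    have key := ih _ hlt (Function.update n c n') (Function.update a c a')
      (by intro d; by_cases hd : d = c
          · subst hd; simpa using ha'lt
          · simpa [hd] using ha d)
      (by intro d; by_cases hd : d = c
          · subst hd; simpa using hdecomp.symm
          · simpa [hd] using hγ d)
    refine key.trans_lt ?_
    rcases hq'.lt_or_eq with h | h
    · have hs : (∑ d, Function.update n c n' d) < ∑ d, n d := by
        apply Finset.sum_lt_sum
        · intro d _
          by_cases hd : d = c
          · subst hd; simpa using hq'
          · simp [hd]
        · exact ⟨c, Finset.mem_univ _, by simpa using h⟩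
      have h1 : N (Function.update a c a') < ω ^ e := by
        apply he
        intro d; by_cases hd : d = c
        · subst hd; simpa using ha'lt
        · simpa [hd] using ha d
      calc _ < ω ^ e * ((∑ d, Function.update n c n' d : ℕ) : Ordinal) + ω ^ e :=
            (add_lt_add_iff_left _).2 h1
        _ = ω ^ e * (((∑ d, Function.update n c n' d) + 1 : ℕ) : Ordinal) := by
            rw [Nat.cast_add, Nat.cast_one, mul_add, mul_one]
        _ ≤ ω ^ e * ((∑ c, n c : ℕ) : Ordinal) := by
            gcongr
            exact hs
        _ ≤ _ := le_self_add
    · subst h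
      rw [Function.update_eq_self]
      apply (add_lt_add_iff_left _).2
      apply N_lt
      rw [hγ c, ← hdecomp] at hδ
      exact (add_lt_add_iff_left _).1 hδ

theorem N_lt_opow (e : Ordinal.{0}) : ∀ γ : C → Ordinal.{0}, (∀ c, γ c < ω ^ e) → N γ < ω ^ e := by
  induction e using Ordinal.limitRecOn with
  | zero =>
    intro γ h
    simp only [Ordinal.opow_zero] at h ⊢
    refine lt_of_le_of_lt (N_le γ 0 ?_) zero_lt_one
    intro c δ hδ
    have : γ c = 0 := by simpa using h c
    rw [this] at hδ
    exact absurd hδ not_lt_zero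
  | add_one e ih =>
    intro γ h
    have hpos : (0 : Ordinal) < ω ^ e := Ordinal.opow_pos _ Ordinal.omega0_pos
    have : ∀ c, ∃ n : ℕ, γ c / ω ^ e = n := by
      intro c
      apply Ordinal.lt_omega0.1
      rw [← Ordinal.lt_mul_iff_div_lt hpos.ne', ← Ordinal.opow_succ]
      exact h c
    choose n hn using this
    have key := N_mul_add e ih γ n (fun c => γ c % ω ^ e) (fun c => Ordinal.mod_lt _ hpos.ne')
      (fun c => by rw [← hn c]; exact (Ordinal.div_add_mod _ _).symm)
    refine key.trans_lt ?_
    have h1 : N (fun c => γ c % ω ^ e) < ω ^ e := ih _ (fun c => Ordinal.mod_lt _ hpos.ne')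
    refine ((add_lt_add_iff_left _).2 h1).trans_le ?_
    rw [← mul_add_one, Ordinal.opow_add, Ordinal.opow_one]
    gcongr
    exact_mod_cast (Ordinal.natCast_lt_omega0 ((∑ c, n c) + 1)).le
  | limit e he ih =>
    intro γ h
    have : ∀ c, ∃ z, z < e ∧ γ c < ω ^ z := fun c => by
      simpa using (Ordinal.lt_opow_of_isSuccLimit Ordinal.omega0_pos.ne' he).1 (h c)
    choose z hz hz' using this
    have hb : Finset.univ.sup z < e := (Finset.sup_lt_iff he.bot_lt).2 (fun c _ => hz c)
    refine (ih _ hb γ (fun c => (hz' c).trans_le ?_)).trans ?_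
    · exact Ordinal.opow_le_opow_right Ordinal.omega0_pos (Finset.le_sup (Finset.mem_univ c))
    · exact (Ordinal.opow_lt_opow_iff_right Ordinal.one_lt_omega0).2 hb
end N

theorem PH {σ : Type v} {P : Type} [Fintype P] (s : P → σ → σ → Prop) (Φ : σ → Prop)
    (comp : ∀ p q x y z, s p x y → s q y z → s q x z) :
    ∀ (b : P → Ordinal.{0}) (x : σ), Rk (fun x y => ∃ p, s p x y) Φ (N b + 1) x →
      ∃ p, Rk (s p) Φ (b p + 1) x := by
  intro b
  induction b using (wfC (C := P)).induction with
  | _ b ih =>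
    intro x hx
    rw [rk_iff] at hx
    obtain ⟨hΦ, hx⟩ := hx
    obtain ⟨x', ⟨p0, hs⟩, hx'⟩ := hx (N b) (Order.lt_add_one_iff.2 le_rfl)
    by_cases h : Rk (s p0) Φ (b p0) x'
    · exact ⟨p0, rk_succ hΦ hs h⟩
    · have : ∃ β, β < b p0 ∧ ¬ Rk (s p0) Φ (β + 1) x' := by
        by_contra hc
        push Not at hc
        exact h (rk_of_succ hx'.inv hc)
      obtain ⟨β, hβ, hn⟩ := this
      obtain ⟨p, hp⟩ := ih (Function.update b p0 β) (update_lt_self_iff.2 hβ) x'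
        (hx'.mono (Order.add_one_le_iff.2 (N_lt b p0 β hβ)))
      by_cases hpp : p = p0
      · subst hpp
        simp only [Function.update_self] at hp
        exact absurd hp hn
      · rw [Function.update_of_ne hpp] at hp
        refine ⟨p, ?_⟩
        rw [rk_iff] at hp ⊢
        refine ⟨hΦ, fun β hβ => ?_⟩
        obtain ⟨z, hz, hz'⟩ := hp.2 β hβ
        exact ⟨z, comp _ _ _ _ _ hs hz, hz'⟩

theorem PH' {σ : Type v} {P : Type} [Finite P] [Nonempty P] (s : P → σ → σ → Prop) (Φ : σ → Prop)
    (comp : ∀ p q x y z, s p x y → s q y z → s q x z)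
    (η : Ordinal.{0}) (x : σ) (h : Rk (fun x y => ∃ p, s p x y) Φ (ω ^ η) x) :
      ∃ p, Rk (s p) Φ (ω ^ η) x := by
  have := Fintype.ofFinite P
  obtain ⟨p, hp⟩ := pigeon (b := ω ^ η) (fun p β => Rk (s p) Φ (β + 1) x)
    (fun p β β' hb hr => hr.mono (by gcongr))
    (fun β hβ => PH s Φ comp (fun _ => β) x (h.mono (Order.add_one_le_iff.2
      (N_lt_opow η _ (fun _ => hβ)))))
  exact ⟨p, rk_of_succ h.inv hp⟩


def Full {X : Type u} (r : X → X → Prop) (η : Ordinal.{0}) (K : ℕ) (𝒯 : Fin K → Set X) : Prop :=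
  ∀ J : Fin K → Prop, Big r (ω ^ η * ((Finset.univ.filter J).card : Ordinal.{0}))
    {u | ∃ j, J j ∧ u ∈ 𝒯 j}

def SK {X : Type u} (r : X → X → Prop) (η : Ordinal.{0}) (K : ℕ) : Prop :=
  ∀ (P : Type) [Finite P] [Nonempty P] (g : X → P) (Z : Set X),
    Big r (ω ^ η * (K : Ordinal.{0})) Z →
    ∃ w : Fin K → P, Full r η K (fun j => {u | u ∈ Z ∧ g u = w j})

def stp {X : Type u} {C P₀ : Type} (r : X → X → Prop) (f : X → X → C) (g₀ : X → P₀) (K : ℕ)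
    (l : (Fin K → C) × P₀) (x x' : Set X × (Fin K → Set X)) : Prop :=
  ∃ y ∈ x.1, g₀ y = l.2 ∧ (∀ u ∈ x'.1, u ∈ x.1 ∧ r y u) ∧
    ∀ j, ∀ u ∈ x'.2 j, u ∈ x.2 j ∧ r y u ∧ f y u = l.1 j

theorem Full.mono {X : Type u} {r : X → X → Prop} {η : Ordinal.{0}} {K : ℕ}
    {𝒯 𝒯' : Fin K → Set X} (h : Full r η K 𝒯) (hs : ∀ j, 𝒯 j ⊆ 𝒯' j) : Full r η K 𝒯' :=
  fun J => (h J).mono le_rfl (fun _ ⟨j, hj, hu⟩ => ⟨j, hj, hs j hu⟩)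

theorem E {X : Type u} {C P₀ : Type} [Finite C] [Nonempty C]
    (r : X → X → Prop) (f : X → X → C) (g₀ : X → P₀) (η : Ordinal.{0}) (K : ℕ)
    (hS : SK r η K) (b : Ordinal.{0}) :
    ∀ (P : Type) [Finite P] [Nonempty P] (g : X → P) (Z : Set X),
      Big r (ω ^ η * (K : Ordinal.{0}) + b) Z →
      ∃ w : Fin K → P, Rk (fun x y => ∃ l, stp r f g₀ K l x y) (fun x => Full r η K x.2) b
        (Z, fun j => {u | u ∈ Z ∧ g u = w j}) := by
  induction b using WellFoundedLT.induction with
  | ind b ih =>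
    intro P _ _ g Z hZ
    by_cases hb : b = 0
    · subst hb
      obtain ⟨w, hw⟩ := hS P g Z (by simpa using hZ)
      refine ⟨w, ?_⟩
      rw [rk_iff]
      exact ⟨hw, fun β hβ => absurd hβ not_lt_zero⟩
    · obtain ⟨w, hw⟩ := pigeon (b := b) (fun (w : Fin K → P) β =>
        Rk (fun x y => ∃ l, stp r f g₀ K l x y) (fun x => Full r η K x.2) (β + 1)
        (Z, fun j => {u | u ∈ Z ∧ g u = w j}))
        (fun p β β' hb hr => hr.mono (by gcongr))
        (by
          intro β hβ
          rw [big_iff] at hZ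
          obtain ⟨y, hy, hB⟩ := hZ (ω ^ η * (K : Ordinal.{0}) + β) ((add_lt_add_iff_left _).2 hβ)
          obtain ⟨w', hw'⟩ := ih β hβ (P × C) (fun u => (g u, f y u)) _ hB
          refine ⟨fun j => (w' j).1, rk_succ ?_ ?_ hw'⟩
          · refine hw'.inv.mono (fun j u hu => ?_)
            exact ⟨hu.1.1, congrArg Prod.fst hu.2⟩
          · refine ⟨(fun j => (w' j).2, g₀ y), y, hy, rfl, fun u hu => hu, fun j u hu => ?_⟩
            exact ⟨⟨hu.1.1, congrArg Prod.fst hu.2⟩, hu.1.2, congrArg Prod.snd hu.2⟩)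
      refine ⟨w, rk_of_succ ?_ hw⟩
      exact (hw 0 (pos_iff_ne_zero.2 hb)).inv

theorem stp_comp {X : Type u} {C P₀ : Type} (r : X → X → Prop) (f : X → X → C) (g₀ : X → P₀)
    (K : ℕ) : ∀ p q x y z, stp r f g₀ K p x y → stp r f g₀ K q y z → stp r f g₀ K q x z := by
  rintro p q x y z ⟨a, ha, -, h1, h2⟩ ⟨a', ha', hg, h1', h2'⟩
  exact ⟨a', (h1 a' ha').1, hg, fun u hu => ⟨(h1 u (h1' u hu).1).1, (h1' u hu).2⟩,
    fun j u hu => ⟨(h2 j u (h2' j u hu).1).1, (h2' j u hu).2⟩⟩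

theorem E' {X : Type u} {C P₀ : Type} [Finite C] [Nonempty C] [Finite P₀] [Nonempty P₀]
    (r : X → X → Prop) (f : X → X → C) (g₀ : X → P₀) (η : Ordinal.{0}) (K : ℕ)
    (hS : SK r η K)
    (P : Type) [Finite P] [Nonempty P] (g : X → P) (Z : Set X)
    (hZ : Big r (ω ^ η * ((K + 1 : ℕ) : Ordinal.{0})) Z) :
      ∃ w : Fin K → P, ∃ l, Rk (stp r f g₀ K l) (fun x => Full r η K x.2) (ω ^ η)
        (Z, fun j => {u | u ∈ Z ∧ g u = w j}) := by
  rw [Nat.cast_add, Nat.cast_one, mul_add, mul_one] at hZ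
  obtain ⟨w, hw⟩ := E r f g₀ η K hS _ P g Z hZ
  exact ⟨w, PH' (stp r f g₀ K) _ (stp_comp r f g₀ K) η _ hw⟩

theorem comb {X : Type u} {C P₀ : Type} 
    (r : X → X → Prop) (f : X → X → C) (g₀ : X → P₀) (η : Ordinal.{0}) (K : ℕ)
    (l : (Fin K → C) × P₀) (J : Fin K → Prop) (b : Ordinal.{0}) :
    ∀ x (U : Set X), Rk (stp r f g₀ K l) (fun x => Full r η K x.2) b x →
      (∀ u ∈ x.1, g₀ u = l.2 → u ∈ U) → (∀ j, J j → x.2 j ⊆ U) →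
      Big r (ω ^ η * ((Finset.univ.filter J).card : Ordinal.{0}) + b) U := by
  induction b using WellFoundedLT.induction with
  | ind b ih =>
    intro x U hx h1 h2
    have hF := hx.inv J
    have hF' := hF.mono (Z' := U) le_rfl (fun u ⟨j, hj, hu⟩ => h2 j hj hu)
    rw [rk_iff] at hx
    rw [big_iff] at hF' ⊢
    intro ε hε
    rcases lt_or_ge ε (ω ^ η * ((Finset.univ.filter J).card : Ordinal.{0})) with h | h
    · exact hF' ε h
    · rw [← Ordinal.add_sub_cancel_of_le h] at hε ⊢
      have hε' := (add_lt_add_iff_left _).1 hε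
      obtain ⟨x', ⟨y, hy, hg, h3, h4⟩, hx'⟩ := hx.2 _ hε'
      refine ⟨y, h1 y hy hg, ih _ hε' x' _ hx' ?_ ?_⟩
      · intro u hu hgu
        exact ⟨h1 u (h3 u hu).1 hgu, (h3 u hu).2⟩
      · intro j hj u hu
        exact ⟨h2 j hj (h4 j u hu).1, (h4 j u hu).2.1⟩

theorem SK_all {X : Type u} (r : X → X → Prop) (η : Ordinal.{0}) (K : ℕ) : SK r η K := by
  induction K with
  | zero =>
    intro P _ _ g Z _
    refine ⟨fun j => j.elim0, fun J => ?_⟩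
    simpa using big_zero
  | succ K ih =>
    intro P _ _ g Z hZ
    obtain ⟨w, ⟨v, p⟩, hw⟩ := E' r (fun _ _ => ()) g η K ih P g Z hZ
    refine ⟨Fin.cons p w, fun J => ?_⟩
    rw [Fin.card_filter_univ_succ]
    by_cases h0 : J 0
    · rw [if_pos h0, Nat.cast_add, Nat.cast_one, mul_add, mul_one]
      refine comb r _ g η K (v, p) (fun j => J j.succ) _ _ _ hw ?_ ?_
      · intro u hu hg
        exact ⟨0, h0, hu, by simpa using hg⟩
      · intro j hj u hu
        exact ⟨j.succ, hj, hu.1, by simpa using hu.2⟩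
    · rw [if_neg h0]
      refine (hw.inv (fun j => J j.succ)).mono le_rfl ?_
      rintro u ⟨j, hj, hu⟩
      exact ⟨j.succ, hj, hu.1, by simpa using hu.2⟩

def rc {X : Type u} {C : Type} (r : X → X → Prop) (f : X → X → C) (c : C) (a u : X) : Prop :=
  r a u ∧ f a u = c

theorem toY {X : Type u} {C : Type} (r : X → X → Prop) (f : X → X → C) (η : Ordinal.{0}) (K : ℕ)
    (v : Fin K → C) (c : C) (M : ℕ) (hM : M ≤ (Finset.univ.filter (fun j => v j = c)).card)
    (b : Ordinal.{0}) : ∀ (x : Set X × (Fin K → Set X)) (W : Set (X × Set X)),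
    Rk (stp r f (fun _ => ()) K (v, ())) (fun x => Full r η K x.2) b x →
    (∀ q : X × Set X, q.1 ∈ x.1 → (∀ u ∈ q.2, ∃ j, v j = c ∧ u ∈ x.2 j) → 
      Big r (ω ^ η * (M : Ordinal.{0})) q.2 → (∀ u ∈ q.2, r q.1 u ∧ f q.1 u = c) → q ∈ W) →
    Big (fun q q' : X × Set X => r q.1 q'.1 ∧ q'.2 ⊆ q.2) b W := by
  induction b using WellFoundedLT.induction with
  | ind b ih =>
    intro x W hx hW
    rw [rk_iff] at hx
    rw [big_iff]
    intro β hβ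
    obtain ⟨x', ⟨y, hy, -, h3, h4⟩, hx'⟩ := hx.2 β hβ
    refine ⟨(y, {u | ∃ j, v j = c ∧ u ∈ x'.2 j}), ?_, ih β hβ x' _ hx' ?_⟩
    · apply hW _ hy
      · rintro u ⟨j, hj, hu⟩
        exact ⟨j, hj, (h4 j u hu).1⟩
      · refine (hx'.inv (fun j => v j = c)).mono ?_ (fun u hu => hu)
        gcongr
      · rintro u ⟨j, hj, hu⟩
        exact ⟨(h4 j u hu).2.1, (h4 j u hu).2.2.trans hj⟩
    · rintro ⟨y', T'⟩ h5 h6 h7 h8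
      refine ⟨hW _ (h3 _ h5).1 ?_ h7 h8, (h3 _ h5).2, fun u hu => h6 u hu⟩
      intro u hu
      obtain ⟨j, hj, hu'⟩ := h6 u hu
      exact ⟨j, hj, (h4 j u hu').1⟩

theorem proj {X Y : Type u} (r : X → X → Prop) (r' : Y → Y → Prop) (π : Y → X)
    (hr : ∀ a b, r' a b → r (π a) (π b)) (b : Ordinal.{0}) :
    ∀ (W : Set Y) (U : Set X), Big r' b W → (∀ q ∈ W, π q ∈ U) → Big r b U := by
  induction b using WellFoundedLT.induction with
  | ind b ih =>
    intro W U hW hU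
    rw [big_iff] at hW ⊢
    intro β hβ
    obtain ⟨q, hq, h⟩ := hW β hβ
    exact ⟨π q, hU q hq, ih β hβ _ _ h (fun q' hq' => ⟨hU q' hq'.1, hr _ _ hq'.2⟩)⟩

theorem comb2 {X : Type u} (r : X → X → Prop) (r' : X × Set X → X × Set X → Prop)
    (hr : ∀ a b, r' a b → r a.1 b.1 ∧ b.2 ⊆ a.2) (β0 : Ordinal.{0}) (b : Ordinal.{0}) :
    ∀ (W : Set (X × Set X)) (U : Set X), Big r' b W → Big r β0 U →
      (∀ q ∈ W, q.1 ∈ U ∧ q.2 ⊆ U ∧ Big r β0 q.2 ∧ ∀ u ∈ q.2, r q.1 u) → Big r (β0 + b) U := by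
  induction b using WellFoundedLT.induction with
  | ind b ih =>
    intro W U hW hU hq
    rw [big_iff] at hW hU ⊢
    intro ε hε
    rcases lt_or_ge ε β0 with h | h
    · exact hU ε h
    · rw [← Ordinal.add_sub_cancel_of_le h] at hε ⊢
      have hε' := (add_lt_add_iff_left _).1 hε
      obtain ⟨q, hqW, hB⟩ := hW _ hε'
      obtain ⟨h1, h2, h3, h4⟩ := hq q hqW
      refine ⟨q.1, h1, ih _ hε' _ _ hB (h3.mono le_rfl fun u hu => ⟨h2 hu, h4 u hu⟩) ?_⟩
      rintro q' ⟨hq', hrq⟩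
      obtain ⟨h1', h2', h3', h4'⟩ := hq q' hq'
      exact ⟨⟨h1', (hr _ _ hrq).1⟩, fun u hu => ⟨h2' hu, h4 u ((hr _ _ hrq).2 hu)⟩, h3', h4'⟩

theorem inner {C : Type} [Fintype C] [Nonempty C] (η : Ordinal.{0}) (δ τ : C → Ordinal.{0})
    (H : ∀ c, ∀ (Y : Type u) (r : Y → Y → Prop) (f : Y → Y → C) (Z : Set Y), Big r (ω ^ η) Z →
      Big (rc r f c) (ω ^ δ c) Z ∨ ∃ c', Big (rc r f c') (τ c') Z) :
    ∀ (n : ℕ) (m : C → ℕ), ∑ c, m c = n → ∃ K : ℕ,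
      ∀ (X : Type u) (r : X → X → Prop) (f : X → X → C) (Z : Set X),
      Big r (ω ^ η * (K : Ordinal.{0})) Z →
      ∃ c, Big (rc r f c) (ω ^ δ c * (m c : Ordinal.{0})) Z ∨ Big (rc r f c) (τ c) Z := by
  intro n
  induction n with
  | zero =>
    intro m hm
    obtain ⟨c⟩ := ‹Nonempty C›
    refine ⟨0, fun X r f Z _ => ⟨c, Or.inl ?_⟩⟩
    have : m c = 0 := by
      rw [Finset.sum_eq_zero_iff] at hm
      exact hm c (Finset.mem_univ _)
    simpa [this] using big_zero
  | succ n ih =>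
    intro m hm
    by_cases h0 : ∃ c, m c = 0
    · obtain ⟨c, hc⟩ := h0
      refine ⟨0, fun X r f Z _ => ⟨c, Or.inl ?_⟩⟩
      simpa [hc] using big_zero
    push Not at h0
    have hdec : ∀ c, ∑ d, Function.update m c (m c - 1) d = n := by
      intro c
      rw [Finset.sum_update_of_mem (Finset.mem_univ c)]
      rw [← Finset.add_sum_erase _ _ (Finset.mem_univ c)] at hm
      have := h0 c
      rw [Finset.sdiff_singleton_eq_erase]
      omega
    choose K hK using fun c => ih _ (hdec c)
    refine ⟨(∑ c, K c) + 1, fun X r f Z hZ => ?_⟩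
    by_contra hcon
    push Not at hcon
    obtain ⟨w, ⟨v, ⟨⟩⟩, hw⟩ := E' r f (fun _ => ()) η (∑ c, K c) (SK_all r η _) Unit (fun _ => ()) Z hZ
    obtain ⟨c, -, hc⟩ : ∃ c ∈ (Finset.univ : Finset C),
        K c ≤ (Finset.univ.filter (fun j => v j = c)).card := by
      apply Finset.exists_le_of_sum_le Finset.univ_nonempty
      have h5 := Finset.card_eq_sum_card_fiberwise (f := v) (s := Finset.univ) (t := Finset.univ)
        (fun _ _ => Finset.mem_coe.2 (Finset.mem_univ _))
      rw [Finset.card_univ, Fintype.card_fin] at h5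
      refine h5.le.trans (le_of_eq ?_)
      exact Finset.sum_congr rfl (fun i _ => by congr)
    set W : Set (X × Set X) := {q | q.1 ∈ Z ∧ q.2 ⊆ Z ∧ Big r (ω ^ η * (K c : Ordinal.{0})) q.2 ∧
      ∀ u ∈ q.2, r q.1 u ∧ f q.1 u = c} with hWdef
    have hW : Big (fun q q' : X × Set X => r q.1 q'.1 ∧ q'.2 ⊆ q.2) (ω ^ η) W := by
      refine toY r f η _ v c (K c) hc _ _ _ hw ?_
      intro q h1 h2 h3 h4
      refine ⟨h1, fun u hu => ?_, h3, h4⟩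
      obtain ⟨j, -, hj⟩ := h2 u hu
      exact hj.1
    rcases H c _ _ (fun q q' => f q.1 q'.1) W hW with h | ⟨c', h⟩
    · have hT : ∀ q ∈ W, Big (rc r f c) (ω ^ δ c * ((m c - 1 : ℕ) : Ordinal.{0})) q.2 := by
        intro q hq
        obtain ⟨c', h' | h'⟩ := hK c X r f q.2 hq.2.2.1
        · by_cases hcc : c' = c
          · subst hcc
            simpa using h'
          · rw [Function.update_of_ne hcc] at h'
            exact absurd (h'.mono le_rfl hq.2.1) (hcon c').1
        · exact absurd (h'.mono le_rfl hq.2.1) (hcon c').2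
      apply (hcon c).1
      have hm1 : m c = (m c - 1) + 1 := by have := h0 c; omega
      rw [hm1, Nat.cast_add, Nat.cast_one, mul_add, mul_one]
      have hne : ∃ q, q ∈ W := by
        rw [big_iff] at h
        obtain ⟨q, hq, -⟩ := h 0 (Ordinal.opow_pos _ Ordinal.omega0_pos)
        exact ⟨q, hq⟩
      obtain ⟨q, hq⟩ := hne
      refine comb2 (rc r f c) _ ?_ _ _ W Z h ((hT q hq).mono le_rfl hq.2.1) ?_
      · rintro a b ⟨⟨h1, h2⟩, h3⟩
        exact ⟨⟨h1, h3⟩, h2⟩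
      · intro q hq
        exact ⟨hq.1, hq.2.1, hT q hq, hq.2.2.2⟩
    · refine (hcon c').2 (proj _ _ Prod.fst ?_ _ W Z h fun q hq => hq.1)
      rintro a b ⟨⟨h1, h2⟩, h3⟩
      exact ⟨h1, h3⟩

theorem main {C : Type} [Fintype C] [Nonempty C] (γ : C → Ordinal.{0}) :
    ∀ (X : Type u) (r : X → X → Prop) (f : X → X → C) (Z : Set X), Big r (ω ^ N γ) Z →
      ∃ c, Big (rc r f c) (ω ^ γ c) Z := by
  induction γ using (wfC (C := C)).induction with
  | _ γ ih =>
    intro X r f Z hZ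
    by_contra hcon
    push Not at hcon
    have hpos : ∀ c, γ c ≠ 0 := by
      intro c hc
      apply hcon c
      rw [hc, Ordinal.opow_zero, big_iff]
      intro β hβ
      rw [big_iff] at hZ
      obtain ⟨y, hy, -⟩ := hZ 0 (Ordinal.opow_pos _ Ordinal.omega0_pos)
      rw [Order.lt_one_iff] at hβ
      subst hβ
      exact ⟨y, hy, big_zero⟩
    have hex : ∀ c, ∃ δ, δ < γ c ∧ ∃ m : ℕ, ¬ Big (rc r f c) (ω ^ δ * (m : Ordinal.{0})) Z := by
      intro c
      have h1 := hcon c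
      rw [big_iff] at h1
      push Not at h1
      obtain ⟨ε, hε, h1⟩ := h1
      obtain ⟨δ, hδ, m, hm⟩ := (Ordinal.lt_omega0_opow (hpos c)).1 hε
      refine ⟨δ, hδ, m, fun h2 => ?_⟩
      rw [big_iff] at h2
      obtain ⟨y, hy, h2⟩ := h2 ε hm
      exact h1 y hy h2
    choose δ hδ m hm using hex
    have hη : Finset.univ.sup (fun c => N (Function.update γ c (δ c))) < N γ := by
      obtain ⟨c0⟩ := ‹Nonempty C›
      rw [Finset.sup_lt_iff (bot_le.trans_lt (N_lt γ c0 (δ c0) (hδ c0)))]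
      exact fun c _ => N_lt γ c (δ c) (hδ c)
    set η := Finset.univ.sup (fun c => N (Function.update γ c (δ c)))
    obtain ⟨K, hK⟩ := inner.{u} η δ (fun c => ω ^ γ c) (by
      intro c Y r f Z hZ
      obtain ⟨c', hc'⟩ := ih (Function.update γ c (δ c)) (update_lt_self_iff.2 (hδ c)) Y r f Z
        (hZ.mono (Ordinal.opow_le_opow_right Ordinal.omega0_pos
          (Finset.le_sup (f := fun c => N (Function.update γ c (δ c))) (Finset.mem_univ c)))
          (fun u hu => hu))
      by_cases hcc : c' = c
      · subst hcc
        left; simpa using hc'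
      · right
        rw [Function.update_of_ne hcc] at hc'
        exact ⟨c', hc'⟩) _ m rfl
    obtain ⟨c, h | h⟩ := hK X r f Z (hZ.mono
      (Ordinal.opow_mul_lt_opow (Ordinal.natCast_lt_omega0 K) hη).le (fun u hu => hu))
    · exact hm c h
    · exact hcon c h

theorem final {C : Type} [Finite C] [Nonempty C] (ξ : Ordinal.{0}) (X : Type u)
    (r : X → X → Prop) (f : X → X → C) (Z : Set X) (hZ : Big r (ω ^ ω ^ ξ) Z) :
    ∃ c, Big (rc r f c) (ω ^ ω ^ ξ) Z := by
  have := Fintype.ofFinite C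
  obtain ⟨c, hc⟩ := pigeon (b := ω ^ ω ^ ξ) (fun c β => Big (rc r f c) (β + 1) Z)
    (fun p β β' hb hr => hr.mono (by gcongr) (fun u hu => hu)) (by
      intro β hβ
      obtain ⟨ζ, hζ, n, hn⟩ := (Ordinal.lt_omega0_opow
        (Ordinal.opow_pos ξ Ordinal.omega0_pos).ne').1 hβ
      by_cases hξ : ξ = 0
      · subst hξ
        rw [Ordinal.opow_zero, Order.lt_one_iff] at hζ
        subst hζ
        rw [Ordinal.opow_zero, one_mul] at hn
        obtain ⟨K, hK⟩ := inner.{u} (C := C) 0 (fun _ => 0) (fun _ => n) (by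
          intro c Y r f Z hZ
          left
          rw [Ordinal.opow_zero, big_iff] at hZ ⊢
          intro ε hε
          obtain ⟨y, hy, -⟩ := hZ ε hε
          rw [Order.lt_one_iff] at hε
          subst hε
          exact ⟨y, hy, big_zero⟩) _ (fun _ => n) rfl
        obtain ⟨c, h⟩ := hK X r f Z (hZ.mono (by
          simpa using (Ordinal.natCast_lt_omega0 K).le) (fun u hu => hu))
        refine ⟨c, Big.mono (α := n) ?_ (Order.add_one_le_iff.2 hn) (fun u hu => hu)⟩
        simpa using h
      · have hlim : ζ + 1 < ω ^ ξ := by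
          have := Ordinal.isSuccLimit_opow_left Ordinal.isSuccLimit_omega0 hξ
          exact this.succ_lt hζ
        obtain ⟨c, hc⟩ := main (fun _ : C => ζ + 1) X r f Z (hZ.mono
          (Ordinal.opow_le_opow_right Ordinal.omega0_pos (N_lt_opow ξ _ (fun _ => hlim)).le)
          (fun u hu => hu))
        refine ⟨c, hc.mono ?_ (fun u hu => hu)⟩
        refine Order.add_one_le_iff.2 (hn.trans ?_)
        exact Ordinal.opow_mul_lt_opow (Ordinal.natCast_lt_omega0 n) (Order.lt_add_one_iff.2 le_rfl))
  refine ⟨c, ?_⟩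
  rw [big_iff]
  intro β hβ
  have := hc β hβ
  rw [big_iff] at this
  exact this β (Order.lt_add_one_iff.2 le_rfl)


theorem derivIter_zero {S : Type*} (T : Set (List S)) : derivIter T 0 = T := by
  simp [derivIter]

theorem derivIter_add_one {S : Type*} (T : Set (List S)) (o : Ordinal.{0}) :
    derivIter T (o + 1) = treeDeriv (derivIter T o) := by
  simp [derivIter]

theorem derivIter_limit {S : Type*} (T : Set (List S)) (o : Ordinal.{0}) (ho : Order.IsSuccLimit o) :
    derivIter T o = ⋂ p : {p : Ordinal.{0} // p < o}, derivIter T p.1 := by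
  rw [derivIter, Ordinal.limitRecOn_limit _ _ _ _ ho]
  rfl

theorem derivIter_step {S : Type*} (T : Set (List S)) (o : Ordinal.{0}) :
    ∀ t ∈ derivIter T o, t ∈ T ∧ ∀ β, β < o → ∃ u ∈ derivIter T β, SPrefix t u := by
  induction o using Ordinal.limitRecOn with
  | zero =>
    intro t ht
    rw [derivIter_zero] at ht
    exact ⟨ht, fun β hβ => absurd hβ not_lt_zero⟩
  | add_one o ih =>
    intro t ht
    rw [derivIter_add_one] at ht
    obtain ⟨h1, h2⟩ := ht
    refine ⟨(ih t h1).1, fun β hβ => ?_⟩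
    rcases (Order.lt_add_one_iff.1 hβ).lt_or_eq with h | rfl
    · exact (ih t h1).2 β h
    · exact h2
  | limit o ho ih =>
    intro t ht
    rw [derivIter_limit T o ho, Set.mem_iInter] at ht
    refine ⟨(ih 0 ho.bot_lt t (ht ⟨0, ho.bot_lt⟩)).1, fun β hβ => ?_⟩
    have h := ht ⟨β + 1, ho.succ_lt hβ⟩
    rw [derivIter_add_one] at h
    exact h.2

theorem SPrefix.tr {S : Type*} {a b c : List S} (h : SPrefix a b) (h' : SPrefix b c) :
    SPrefix a c := by
  refine ⟨h.1.trans h'.1, ?_⟩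
  rintro rfl
  exact h.2 (h.1.eq_of_length (le_antisymm h.1.length_le h'.1.length_le))

theorem big_above {S : Type u} (T : Set (List S)) (o : Ordinal.{0}) :
    ∀ t ∈ derivIter T o, Big SPrefix o {u | u ∈ T ∧ SPrefix t u} := by
  induction o using WellFoundedLT.induction with
  | ind o ih =>
    intro t ht
    rw [big_iff]
    intro β hβ
    obtain ⟨u, hu, htu⟩ := (derivIter_step T o t ht).2 β hβ
    refine ⟨u, ⟨(derivIter_step T β u hu).1, htu⟩, (ih β hβ u hu).mono le_rfl ?_⟩
    intro w hw
    exact ⟨⟨hw.1, SPrefix.tr htu hw.2⟩, hw.2⟩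

theorem big_of_order {S : Type u} (T : Set (List S)) (α : Ordinal.{0})
    (h : (α : WithTop Ordinal.{0}) ≤ treeOrder T) : Big SPrefix α T := by
  rw [big_iff]
  intro β hβ
  have hne : (derivIter T β).Nonempty := by
    by_contra hc
    rw [Set.not_nonempty_iff_eq_empty] at hc
    rw [treeOrder, dif_pos ⟨β, hc⟩, WithTop.coe_le_coe] at h
    have h2 : sInf {o : Ordinal.{0} | derivIter T o = ∅} ≤ β := csInf_le' hc
    exact absurd (h.trans h2) (not_le.2 hβ)
  obtain ⟨t, ht⟩ := hne
  exact ⟨t, (derivIter_step T β t ht).1, big_above T β t ht⟩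

def D (α : Ordinal.{0}) : Set (List Ordinal.{0}) :=
  {l | l ≠ [] ∧ l.Pairwise (fun a b => b < a) ∧ ∀ x ∈ l, x < α}

theorem isBTree_D (α : Ordinal.{0}) : IsBTree (D α) := by
  refine ⟨fun h => h.1 rfl, ?_⟩
  intro s t ht hst hs
  exact ⟨hs, ht.2.1.sublist hst.sublist, fun x hx => ht.2.2 x (hst.subset hx)⟩

theorem sprefix_iff {S : Type*} {s t : List S} : SPrefix s t ↔ ∃ l b, t = s ++ (l ++ [b]) := by
  constructor
  · rintro ⟨⟨l, rfl⟩, h⟩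
    rcases List.eq_nil_or_concat l with rfl | ⟨l', b, rfl⟩
    · simp at h
    · exact ⟨l', b, by simp⟩
  · rintro ⟨l, b, rfl⟩
    exact ⟨⟨_, rfl⟩, by simp⟩

theorem derivIter_D (α o : Ordinal.{0}) : derivIter (D α) o = {l | l ∈ D α ∧ ∀ x ∈ l, o ≤ x} := by
  induction o using Ordinal.limitRecOn with
  | zero => rw [derivIter_zero]; ext l; simp
  | add_one o ih =>
    rw [derivIter_add_one, ih]
    ext l
    constructor
    · rintro ⟨⟨h1, h2⟩, t, ⟨h3, h4⟩, hlt⟩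
      refine ⟨h1, fun x hx => ?_⟩
      obtain ⟨l', b, rfl⟩ := sprefix_iff.1 hlt
      have h5 := (List.pairwise_append.1 h3.2.1).2.2 x hx b (by simp)
      exact Order.add_one_le_iff.2 ((h4 b (by simp)).trans_lt h5)
    · rintro ⟨h1, h2⟩
      refine ⟨⟨h1, fun x hx => (Order.add_one_le_iff.1 (h2 x hx)).le⟩, l ++ [o], ⟨⟨by simp, ?_, ?_⟩, ?_⟩,
        sprefix_iff.2 ⟨[], o, by simp⟩⟩
      · rw [List.pairwise_append]
        refine ⟨h1.2.1, by simp, fun x hx b hb => ?_⟩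
        rw [List.mem_singleton] at hb
        subst hb
        exact Order.add_one_le_iff.1 (h2 x hx)
      · intro x hx
        rw [List.mem_append, List.mem_singleton] at hx
        rcases hx with hx | rfl
        · exact h1.2.2 x hx
        · obtain ⟨y, hy⟩ := List.exists_mem_of_ne_nil l h1.1
          exact (Order.add_one_le_iff.1 (h2 y hy)).trans (h1.2.2 y hy)
      · intro x hx
        rw [List.mem_append, List.mem_singleton] at hx
        rcases hx with hx | rfl
        · exact (Order.add_one_le_iff.1 (h2 x hx)).le
        · exact le_rfl
  | limit o ho ih =>
    rw [derivIter_limit _ o ho]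
    ext l
    rw [Set.mem_iInter]
    constructor
    · intro h
      have h' : ∀ p, p < o → l ∈ D α ∧ ∀ x ∈ l, p ≤ x := fun p hp => by
        have := h ⟨p, hp⟩
        rw [ih p hp] at this
        exact this
      refine ⟨(h' 0 ho.bot_lt).1, fun x hx => ?_⟩
      by_contra hc
      rw [not_le] at hc
      have := (h' (x + 1) (ho.succ_lt hc)).2 x hx
      exact absurd (Order.add_one_le_iff.1 this) (lt_irrefl _)
    · rintro ⟨h1, h2⟩ ⟨p, hp⟩
      show l ∈ derivIter (D α) p
      rw [ih p hp]
      exact ⟨h1, fun x hx => hp.le.trans (h2 x hx)⟩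

theorem treeOrder_D (α : Ordinal.{0}) : treeOrder (D α) = (α : WithTop Ordinal.{0}) := by
  have key : ∀ o, derivIter (D α) o = ∅ ↔ α ≤ o := by
    intro o
    rw [derivIter_D, Set.eq_empty_iff_forall_notMem]
    constructor
    · intro h
      by_contra hc
      rw [not_le] at hc
      exact h [o] ⟨⟨by simp, by simp, by simpa using hc⟩, by simp⟩
    · rintro h l ⟨h1, h2⟩
      obtain ⟨y, hy⟩ := List.exists_mem_of_ne_nil l h1.1
      exact absurd ((h.trans (h2 y hy)).trans_lt (h1.2.2 y hy)) (lt_irrefl _)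
  rw [treeOrder, dif_pos ⟨α, (key α).2 le_rfl⟩]
  congr 1
  have : {o : Ordinal.{0} | derivIter (D α) o = ∅} = Set.Ici α := by
    ext o; exact key o
  rw [this, csInf_Ici]

section strat
variable {X : Type u} [Inhabited X] (R : X → X → Prop) (T : Set X)

def pick (Z : Set X) (β : Ordinal.{0}) : X :=
  if h : ∃ y ∈ Z, Big R β {u | u ∈ Z ∧ R y u} then h.choose else default

def st (l : List Ordinal.{0}) : Set X :=
  l.foldl (fun Z β => {u | u ∈ Z ∧ R (pick R Z β) u}) T

def th (l : List Ordinal.{0}) : X := pick R (st R T l.dropLast) (l.getLast?.getD 0)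

theorem st_concat (l : List Ordinal.{0}) (b : Ordinal.{0}) :
    st R T (l ++ [b]) = {u | u ∈ st R T l ∧ R (th R T (l ++ [b])) u} := by
  simp [st, th]

theorem st_append (l l' : List Ordinal.{0}) : st R T (l ++ l') ⊆ st R T l := by
  induction l' using List.reverseRecOn with
  | nil => simp
  | append_singleton l' b ih =>
    rw [← List.append_assoc, st_concat]
    exact fun u hu => ih hu.1

theorem pick_spec (Z : Set X) (β : Ordinal.{0}) (h : ∃ y ∈ Z, Big R β {u | u ∈ Z ∧ R y u}) :
    pick R Z β ∈ Z ∧ Big R β {u | u ∈ Z ∧ R (pick R Z β) u} := by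
  rw [pick, dif_pos h]
  exact h.choose_spec

theorem th_spec (α : Ordinal.{0}) (h : Big R α T) (l : List Ordinal.{0}) :
    ∀ b, l ++ [b] ∈ D α → th R T (l ++ [b]) ∈ st R T l ∧ Big R b (st R T (l ++ [b])) := by
  induction l using List.reverseRecOn with
  | nil =>
    intro b hb
    rw [st_concat]
    rw [big_iff] at h
    have := pick_spec R T b (h b (hb.2.2 b (by simp)))
    simpa [th, st] using this
  | append_singleton l a ih =>
    intro b hb
    have h1 : l ++ [a] ∈ D α := (isBTree_D α).2 _ _ hb ⟨[b], rfl⟩ (by simp)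
    have hab : b < a := (List.pairwise_append.1 hb.2.1).2.2 a (by simp) b (by simp)
    have h2 := (ih a h1).2
    rw [big_iff] at h2
    have := pick_spec R _ b (h2 b hab)
    rw [st_concat R T (l ++ [a])]
    have he : th R T (l ++ [a] ++ [b]) = pick R (st R T (l ++ [a])) b := by
      simp [th]
    rw [he]
    exact this

theorem strategy (α : Ordinal.{0}) (h : Big R α T) :
    Set.MapsTo (th R T) (D α) T ∧
      ∀ s ∈ D α, ∀ t ∈ D α, SPrefix s t → R (th R T s) (th R T t) := by
  constructor
  · intro l hl
    rcases List.eq_nil_or_concat l with rfl | ⟨l, b, rfl⟩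
    · exact absurd rfl hl.1
    · rw [List.concat_eq_append] at *
      have := st_append R T [] l (by simpa using (th_spec R T α h l b hl).1)
      simpa [st] using this
  · intro s hs t ht hst
    obtain ⟨l, b, rfl⟩ := sprefix_iff.1 hst
    rw [← List.append_assoc] at ht ⊢
    have h1 := (th_spec R T α h _ b ht).1
    have h2 := st_append R T s l h1
    rcases List.eq_nil_or_concat s with rfl | ⟨s, a, rfl⟩
    · exact absurd rfl hs.1
    · rw [List.concat_eq_append] at *
      rw [st_concat] at h2
      exact h2.2
end strat
end T13


/-- for any B-tree `T` with `o(T) ≥ ω^{ω^ξ}` and any coloring of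
`Λ(T)` by a finite set, there are a B-tree `T₀` with `o(T₀) = ω^{ω^ξ}`, a monotone
`θ : T₀ → T` and a color `x` with `f(θ(s), θ(t)) = x` on `Λ(T₀)`. -/
theorem statement13 {S C : Type*} [Finite C] (ξ : Ordinal.{0}) (T : Set (List S))
    (hT : IsBTree T) (ho : ↑(omega0 ^ omega0 ^ ξ) ≤ treeOrder T)
    (f : List S → List S → C) :
    ∃ (T₀ : Set (List Ordinal.{0})) (θ : List Ordinal.{0} → List S) (x : C),
      IsBTree T₀ ∧ treeOrder T₀ = ↑(omega0 ^ omega0 ^ ξ) ∧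
      MonotoneTreeMap θ T₀ T ∧
      ∀ s ∈ T₀, ∀ t ∈ T₀, SPrefix s t → f (θ s) (θ t) = x := by
  classical
  have hB := T13.big_of_order T _ ho
  have hne : Nonempty C := ⟨f [] []⟩
  obtain ⟨n, ⟨e⟩⟩ := Finite.exists_equiv_fin C
  have : Nonempty (Fin n) := ⟨e (f [] [])⟩
  obtain ⟨c, hc⟩ := T13.final ξ (List S) SPrefix (fun a b => e (f a b)) T hB
  obtain ⟨h1, h2⟩ := T13.strategy _ T _ hc
  refine ⟨T13.D (ω ^ ω ^ ξ), T13.th (T13.rc SPrefix (fun a b => e (f a b)) c) T, e.symm c,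
    T13.isBTree_D _, T13.treeOrder_D _, ⟨h1, fun s hs t ht hst => (h2 s hs t ht hst).1⟩,
    fun s hs t ht hst => ?_⟩
  exact e.eq_symm_apply.mpr (h2 s hs t ht hst).2
end
end

section
/- Let ξ be a nonzero ordinal and S a finite set. For any function f : ℰ_ξ → S, there exist an extended monotone map (θ,e) from 𝒯_ξ into 𝒯_ξ and a function g : 𝒯_ξ → S such that g(s) = f(θ(s), e(t)) for all (s,t) ∈ ℰ_ξ. -/
noncomputable section
open Ordinal

theorem mem_succ {o : Ordinal.{0}} {t : List Ordinal.{0}} :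
    t ∈ calT (o + 1) ↔ t = [o + 1] ∨ ∃ s ∈ calT o, t = (o + 1) :: s := by
  rw [calT_succ]
  simp only [Set.mem_union, Set.mem_singleton_iff, Set.mem_image, eq_comm]

theorem exists_succ (z : Ordinal.{0}) : ∀ t ∈ calT z, ∃ n, n < z ∧ t ∈ calT (n + 1) := by
  induction z using Ordinal.limitRecOn with
  | zero => intro t ht; rw [calT_zero] at ht; exact ht.elim
  | add_one o ih => intro t ht; exact ⟨o, by simp, ht⟩
  | limit o h ih =>
    intro t ht
    rw [calT_limit o h] at ht
    obtain ⟨⟨p, hp⟩, ht⟩ := Set.mem_iUnion.1 ht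
    obtain ⟨n, hn, hh⟩ := ih p hp t ht
    exact ⟨n, hn.trans hp, hh⟩

theorem sub_limit {o n : Ordinal.{0}} (h : Order.IsSuccLimit o) (hn : n < o) :
    calT n ⊆ calT o := by
  rw [calT_limit o h]
  exact Set.subset_iUnion (fun p : {p : Ordinal.{0} // p < o} => calT p.1) ⟨n, hn⟩

theorem head_succ {o : Ordinal.{0}} {t : List Ordinal.{0}} (h : t ∈ calT (o + 1)) :
    t.head? = some (o + 1) := by
  rcases mem_succ.1 h with rfl | ⟨s, _, rfl⟩ <;> rfl

theorem head_pre {A : Type*} {s t : List A} {a : A} (h : s.head? = some a) (hst : s <+: t) :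
    t.head? = some a := by
  obtain ⟨r, rfl⟩ := hst
  cases s <;> simp_all

theorem nil_notMem (o : Ordinal.{0}) : [] ∉ calT o := by
  intro h
  obtain ⟨n, _, h⟩ := exists_succ o _ h
  simpa using head_succ h

theorem mem_of_pre {o z : Ordinal.{0}} {s u : List Ordinal.{0}} (hs : s ∈ calT (o + 1))
    (hu : u ∈ calT z) (h : s <+: u) : u ∈ calT (o + 1) := by
  obtain ⟨n, _, hn⟩ := exists_succ z u hu
  have h1 := head_pre (head_succ hs) h
  rw [head_succ hn] at h1
  have : n + 1 = o + 1 := by simpa using h1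
  rwa [← this]

theorem mem_of_pre' {o z : Ordinal.{0}} {s u : List Ordinal.{0}} (hu : u ∈ calT (o + 1))
    (hs : s ∈ calT z) (h : s <+: u) : s ∈ calT (o + 1) := by
  obtain ⟨n, _, hn⟩ := exists_succ z s hs
  have h1 := head_pre (head_succ hn) h
  rw [head_succ hu] at h1
  have : n + 1 = o + 1 := by simpa using h1.symm
  rwa [← this]

theorem max_sub {o z : Ordinal.{0}} {s : List Ordinal.{0}} (h : s ∈ MaxNodes (calT (o + 1)))
    (hs : s ∈ calT z) : s ∈ MaxNodes (calT z) :=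
  ⟨hs, fun ⟨u, hu, h'⟩ => h.2 ⟨u, mem_of_pre h.1 hu h'.1, h'⟩⟩

theorem sprefix_cons {A : Type*} {a : A} {s t : List A} :
    SPrefix (a :: s) (a :: t) ↔ SPrefix s t := by
  simp [SPrefix, List.cons_prefix_cons]

theorem max_cons {o : Ordinal.{0}} {s : List Ordinal.{0}} (h : s ∈ MaxNodes (calT o)) :
    (o + 1) :: s ∈ MaxNodes (calT (o + 1)) := by
  refine ⟨mem_succ.2 (Or.inr ⟨s, h.1, rfl⟩), ?_⟩
  rintro ⟨u, hu, hp⟩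
  rcases mem_succ.1 hu with rfl | ⟨v, hv, rfl⟩
  · rw [sprefix_cons] at hp
    have := hp.1
    simp at this
    exact hp.2 this
  · exact h.2 ⟨v, hv, sprefix_cons.1 hp⟩

theorem max_cons_inv {o : Ordinal.{0}} {t : List Ordinal.{0}} (h : t ∈ MaxNodes (calT (o + 1))) :
    (t = [o + 1] ∧ calT o = ∅) ∨ ∃ s ∈ MaxNodes (calT o), t = (o + 1) :: s := by
  rcases mem_succ.1 h.1 with rfl | ⟨v, hv, rfl⟩
  · left
    refine ⟨rfl, Set.eq_empty_iff_forall_notMem.2 fun s hs => h.2 ⟨_, mem_succ.2 (Or.inr ⟨s, hs, rfl⟩), ?_⟩⟩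
    rw [sprefix_cons]
    refine ⟨by simp, ?_⟩
    rintro rfl
    exact nil_notMem _ hs
  · right
    exact ⟨v, ⟨hv, fun ⟨u, hu, hp⟩ => h.2 ⟨_, mem_succ.2 (Or.inr ⟨u, hu, rfl⟩), sprefix_cons.2 hp⟩⟩, rfl⟩

section ext
variable {A B D : Type*} {θ e : List A → List B} {θ' e' : List B → List D}
  {T : Set (List A)} {U : Set (List B)} {V : Set (List D)}

theorem ext_comp (h' : ExtMonotoneTreeMap θ' e' U V) (h : ExtMonotoneTreeMap θ e T U) :
    ExtMonotoneTreeMap (θ' ∘ θ) (e' ∘ e) T V := by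
  obtain ⟨⟨a, b⟩, c, d⟩ := h
  obtain ⟨⟨a', b'⟩, c', d'⟩ := h'
  refine ⟨⟨a'.comp a, fun s hs t ht hst => b' _ (a hs) _ (a ht) (b _ hs _ ht hst)⟩, c'.comp c, ?_⟩
  intro s hs
  have h1 := d s hs
  refine List.IsPrefix.trans ?_ (d' _ (c hs))
  by_cases h2 : θ s = e s
  · simp [h2]
  · exact (b' _ (a hs.1) _ (c hs).1 ⟨h1, h2⟩).1

theorem ext_pre (h : ExtMonotoneTreeMap θ e T U) {s t : List A} (hs : s ∈ T) (ht : t ∈ MaxNodes T)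
    (hst : s <+: t) : θ s <+: e t := by
  refine List.IsPrefix.trans ?_ (h.2.2 _ ht)
  by_cases h2 : s = t
  · simp [h2]
  · exact (h.1.2 _ hs _ ht.1 ⟨hst, h2⟩).1

end ext

theorem ext_id (o : Ordinal.{0}) : ExtMonotoneTreeMap id id (calT o) (calT o) :=
  ⟨⟨Set.mapsTo_id _, fun _ _ _ _ h => h⟩, Set.mapsTo_id _, fun _ _ => List.prefix_refl _⟩

theorem ext_incl {o n : Ordinal.{0}} (h : Order.IsSuccLimit o) (hn : n < o) :
    ExtMonotoneTreeMap id id (calT (n + 1)) (calT o) :=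
  have hs := sub_limit h (h.succ_lt hn)
  ⟨⟨fun _ h => hs h, fun _ _ _ _ h => h⟩, fun _ h => max_sub h (hs h.1), fun _ _ => List.prefix_refl _⟩

theorem ext_shift (o : Ordinal.{0}) :
    ExtMonotoneTreeMap (List.cons (o + 1)) (List.cons (o + 1)) (calT o) (calT (o + 1)) :=
  ⟨⟨fun _ h => mem_succ.2 (Or.inr ⟨_, h, rfl⟩), fun _ _ _ _ h => sprefix_cons.2 h⟩,
    fun _ h => max_cons h, fun _ _ => List.prefix_refl _⟩

theorem ext_le (z : Ordinal.{0}) : ∀ n ≤ z, ∃ θ e, ExtMonotoneTreeMap θ e (calT n) (calT z) := by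
  induction z using Ordinal.limitRecOn with
  | zero => intro n hn; obtain rfl : n = 0 := by simpa using hn
            exact ⟨_, _, ext_id _⟩
  | add_one o ih =>
    intro n hn
    rcases hn.eq_or_lt with rfl | hn
    · exact ⟨_, _, ext_id _⟩
    · obtain ⟨θ, e, h⟩ := ih n (Order.lt_add_one_iff.1 hn)
      exact ⟨_, _, ext_comp (ext_shift o) h⟩
  | limit o h ih =>
    intro n hn
    rcases hn.eq_or_lt with rfl | hn
    · exact ⟨_, _, ext_id _⟩
    · obtain ⟨θ, e, h'⟩ := ih (n + 1) (h.succ_lt hn) n (Order.le_succ n)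
      exact ⟨_, _, ext_comp (ext_incl h hn) h'⟩

def csMap (a : Ordinal.{0}) (θ : List Ordinal.{0} → List Ordinal.{0}) (t : List Ordinal.{0}) :
    List Ordinal.{0} := if t.tail = [] then [a] else a :: θ t.tail

theorem csMap_one (a b : Ordinal.{0}) (θ) : csMap a θ [b] = [a] := by simp [csMap]

theorem csMap_cons (a b : Ordinal.{0}) (θ) {s : List Ordinal.{0}} {o} (h : s ∈ calT o) :
    csMap a θ (b :: s) = a :: θ s := by
  have : s ≠ [] := by rintro rfl; exact nil_notMem _ h
  simp [csMap, this]

theorem ext_cs {o : Ordinal.{0}} {θ e} (h : ExtMonotoneTreeMap θ e (calT o) (calT o)) :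
    ExtMonotoneTreeMap (csMap (o + 1) θ) (csMap (o + 1) e) (calT (o + 1)) (calT (o + 1)) := by
  refine ⟨⟨?_, ?_⟩, ?_, ?_⟩
  · intro t ht
    rcases mem_succ.1 ht with rfl | ⟨s, hs, rfl⟩
    · rwa [csMap_one]
    · rw [csMap_cons _ _ _ hs]
      exact mem_succ.2 (Or.inr ⟨_, h.1.1 hs, rfl⟩)
  · intro s hs t ht hst
    rcases mem_succ.1 ht with rfl | ⟨t', ht', rfl⟩
    · exfalso
      rcases mem_succ.1 hs with rfl | ⟨s', hs', rfl⟩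
      · exact hst.2 rfl
      · have := (sprefix_cons.1 hst).1
        simp at this
        exact nil_notMem _ (this ▸ hs')
    rw [csMap_cons _ _ _ ht']
    rcases mem_succ.1 hs with rfl | ⟨s', hs', rfl⟩
    · rw [csMap_one, sprefix_cons]
      refine ⟨by simp, fun h' => nil_notMem o ?_⟩
      rw [h']; exact h.1.1 ht'
    · rw [csMap_cons _ _ _ hs', sprefix_cons]
      exact h.1.2 _ hs' _ ht' (sprefix_cons.1 hst)
  · intro t ht
    rcases max_cons_inv ht with ⟨rfl, _⟩ | ⟨s, hs, rfl⟩
    · rwa [csMap_one]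
    · rw [csMap_cons _ _ _ hs.1]
      exact max_cons (h.2.1 hs)
  · intro t ht
    rcases max_cons_inv ht with ⟨rfl, _⟩ | ⟨s, hs, rfl⟩
    · rw [csMap_one, csMap_one]
    · rw [csMap_cons _ _ _ hs.1, csMap_cons _ _ _ hs.1]
      exact List.cons_prefix_cons.2 ⟨rfl, h.2.2 _ hs⟩

def hd (t : List Ordinal.{0}) : Ordinal.{0} := sInf {n | t.headD 0 ≤ n + 1}

theorem hd_eq {o : Ordinal.{0}} {t} (h : t ∈ calT (o + 1)) : hd t = o := by
  have : hd t = sInf (Set.Ici o) := by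
    rcases mem_succ.1 h with rfl | ⟨s, _, rfl⟩ <;>
      simp [hd, Set.Ici]
  rw [this, csInf_Ici]

theorem max_lim {z : Ordinal.{0}} (hz : Order.IsSuccLimit z) {t} (h : t ∈ MaxNodes (calT z)) :
    ∃ n, n < z ∧ t ∈ MaxNodes (calT (n + 1)) := by
  obtain ⟨n, hn, ht⟩ := exists_succ z t h.1
  exact ⟨n, hn, ht, fun ⟨u, hu, hp⟩ => h.2 ⟨u, sub_limit hz (hz.succ_lt hn) hu, hp⟩⟩

theorem ext_glue {z : Ordinal.{0}} (hz : Order.IsSuccLimit z)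
    {Θ E : Ordinal.{0} → List Ordinal.{0} → List Ordinal.{0}} {V : Set (List Ordinal.{0})}
    (h : ∀ n, n < z → ExtMonotoneTreeMap (Θ n) (E n) (calT (n + 1)) V) :
    ExtMonotoneTreeMap (fun t => Θ (hd t) t) (fun t => E (hd t) t) (calT z) V := by
  refine ⟨⟨?_, ?_⟩, ?_, ?_⟩
  · intro t ht
    obtain ⟨n, hn, ht⟩ := exists_succ z t ht
    simp only [hd_eq ht]
    exact (h n hn).1.1 ht
  · intro s hs t ht hst
    obtain ⟨n, hn, hs⟩ := exists_succ z s hs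
    have ht := mem_of_pre hs ht hst.1
    simp only [hd_eq ht, hd_eq hs]
    exact (h n hn).1.2 _ hs _ ht hst
  · intro t ht
    obtain ⟨n, hn, ht⟩ := max_lim hz ht
    simp only [hd_eq ht.1]
    exact (h n hn).2.1 ht
  · intro t ht
    obtain ⟨n, hn, ht⟩ := max_lim hz ht
    simp only [hd_eq ht.1]
    exact (h n hn).2.2 _ ht

theorem leafColor {C : Type*} [Finite C] (z : Ordinal.{0}) : ∀ (f : List Ordinal.{0} → C),
    ∃ θ e, ExtMonotoneTreeMap θ e (calT z) (calT z) ∧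
      ∃ c, ∀ t ∈ MaxNodes (calT z), f (e t) = c := by
  induction z using Ordinal.limitRecOn with
  | zero => intro f; exact ⟨_, _, ext_id _, f [], fun t ht => by
              have := ht.1; rw [calT_zero] at this; exact this.elim⟩
  | add_one o ih =>
    intro f
    by_cases h0 : calT o = ∅
    · refine ⟨_, _, ext_id _, f [o + 1], fun t ht => ?_⟩
      rcases max_cons_inv ht with ⟨rfl, _⟩ | ⟨s, hs, rfl⟩
      · rfl
      · have := hs.1; rw [h0] at this; exact this.elim
    · obtain ⟨θ, e, h, c, hc⟩ := ih (fun t => f ((o + 1) :: t))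
      refine ⟨_, _, ext_cs h, c, fun t ht => ?_⟩
      rcases max_cons_inv ht with ⟨rfl, h1⟩ | ⟨s, hs, rfl⟩
      · exact (h0 h1).elim
      · rw [csMap_cons _ _ _ hs.1]; exact hc s hs
  | limit o h ih =>
    intro f
    have h1 : ∀ n, n < o → ∃ θ e, ExtMonotoneTreeMap θ e (calT (n + 1)) (calT o) ∧
        ∃ c, ∀ t ∈ MaxNodes (calT (n + 1)), f (e t) = c := by
      intro n hn
      obtain ⟨θ, e, h1, c, hc⟩ := ih (n + 1) (h.succ_lt hn) f
      exact ⟨_, _, ext_comp (ext_incl h hn) h1, c, hc⟩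
    have h2 : ∃ c, ∀ n, n < o → ∃ m, n ≤ m ∧ m < o ∧
        ∃ θ e, ExtMonotoneTreeMap θ e (calT (m + 1)) (calT o) ∧
        ∀ t ∈ MaxNodes (calT (m + 1)), f (e t) = c := by
      by_contra hcon
      push Not at hcon
      choose N hN hN' using hcon
      have hne : Nonempty C := ⟨f []⟩
      obtain ⟨c0, hc0⟩ := Finite.exists_max N
      obtain ⟨θ, e, h1, c, hc⟩ := h1 (N c0) (hN c0)
      obtain ⟨t, ht, hh⟩ := hN' c (N c0) (hc0 c) (hN c0) θ e h1
      exact hh (hc t ht)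
    obtain ⟨c, hc⟩ := h2
    have h3 : ∀ n, ∃ θ e, n < o → (ExtMonotoneTreeMap θ e (calT (n + 1)) (calT o) ∧
        ∀ t ∈ MaxNodes (calT (n + 1)), f (e t) = c) := by
      intro n
      by_cases hn : n < o
      · obtain ⟨m, hm, hmo, θ, e, h4, h5⟩ := hc n hn
        obtain ⟨θ', e', h6⟩ := ext_le (m + 1) (n + 1) (by gcongr)
        exact ⟨_, _, fun _ => ⟨ext_comp h4 h6, fun t ht => h5 _ (h6.2.1 ht)⟩⟩
      · exact ⟨id, id, fun h => (hn h).elim⟩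
    choose Θ E h4 using h3
    refine ⟨_, _, ext_glue h (fun n hn => (h4 n hn).1), c, fun t ht => ?_⟩
    obtain ⟨n, hn, ht⟩ := max_lim h ht
    simp only [hd_eq ht.1]
    exact (h4 n hn).2 t ht

theorem mainColor {C : Type*} [Finite C] (z : Ordinal.{0}) :
    ∀ (f : List Ordinal.{0} → List Ordinal.{0} → C),
    ∃ (θ e : List Ordinal.{0} → List Ordinal.{0}) (g : List Ordinal.{0} → C),
      ExtMonotoneTreeMap θ e (calT z) (calT z) ∧
      ∀ s ∈ calT z, ∀ t ∈ MaxNodes (calT z), s <+: t → g s = f (θ s) (e t) := by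
  induction z using Ordinal.limitRecOn with
  | zero => intro f; exact ⟨_, _, f [], ext_id _, fun t ht => by
              rw [calT_zero] at ht; exact ht.elim⟩
  | add_one o ih =>
    intro f
    by_cases h0 : calT o = ∅
    · refine ⟨_, _, fun s => f s s, ext_id _, fun s hs t ht hst => ?_⟩
      have key : ∀ t ∈ calT (o + 1), t = [o + 1] := fun t ht => by
        rcases mem_succ.1 ht with rfl | ⟨s, hs, rfl⟩
        · rfl
        · rw [h0] at hs; exact hs.elim
      simp [key s hs, key t ht.1]
    · obtain ⟨θ, e, h, c, hc⟩ := leafColor o (fun t => f [o + 1] ((o + 1) :: t))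
      obtain ⟨θ', e', g, h', hg⟩ := ih (fun s t => f ((o + 1) :: θ s) ((o + 1) :: e t))
      refine ⟨_, _, fun s => if s.tail = [] then c else g s.tail, ext_cs (ext_comp h h'),
        fun s hs t ht hst => ?_⟩
      rcases max_cons_inv ht with ⟨rfl, h1⟩ | ⟨t', ht', rfl⟩
      · exact (h0 h1).elim
      rw [csMap_cons _ _ _ ht'.1]
      rcases mem_succ.1 hs with rfl | ⟨s', hs', rfl⟩
      · rw [csMap_one]
        simpa using (hc _ (h'.2.1 ht')).symm
      · rw [csMap_cons _ _ _ hs']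
        have : s' ≠ [] := by rintro rfl; exact nil_notMem _ hs'
        simp only [List.tail_cons, this, if_false]
        exact hg s' hs' t' ht' (List.cons_prefix_cons.1 hst).2
  | limit o h ih =>
    intro f
    have h3 : ∀ n, ∃ (θ e : List Ordinal.{0} → List Ordinal.{0}) (g : List Ordinal.{0} → C),
        n < o → (ExtMonotoneTreeMap θ e (calT (n + 1)) (calT o) ∧
        ∀ s ∈ calT (n + 1), ∀ t ∈ MaxNodes (calT (n + 1)), s <+: t → g s = f (θ s) (e t)) := by
      intro n
      by_cases hn : n < o
      · obtain ⟨θ, e, g, h1, h2⟩ := ih (n + 1) (h.succ_lt hn) f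
        exact ⟨_, _, g, fun _ => ⟨ext_comp (ext_incl h hn) h1, h2⟩⟩
      · exact ⟨id, id, f [], fun h => (hn h).elim⟩
    choose Θ E G h4 using h3
    refine ⟨_, _, fun s => G (hd s) s, ext_glue h (fun n hn => (h4 n hn).1), fun s hs t ht hst => ?_⟩
    obtain ⟨n, hn, ht⟩ := max_lim h ht
    have hs := mem_of_pre' ht.1 hs hst
    simp only [hd_eq ht.1, hd_eq hs]
    exact (h4 n hn).2 s hs t ht hst

/-- for any coloring `f : ℰ_ξ → S` by a finite set, there are an
extended monotone map `(θ,e)` of `𝒯_ξ` into itself and `g : 𝒯_ξ → S` with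
`g(s) = f(θ(s), e(t))` for all `(s,t) ∈ ℰ_ξ`. -/
theorem statement16 {C : Type*} [Finite C] (ξ : Ordinal.{0}) (hξ : ξ ≠ 0)
    (f : List Ordinal.{0} → List Ordinal.{0} → C) :
    ∃ (θ e : List Ordinal.{0} → List Ordinal.{0}) (g : List Ordinal.{0} → C),
      ExtMonotoneTreeMap θ e (calT ξ) (calT ξ) ∧
      ∀ s ∈ calT ξ, ∀ t ∈ MaxNodes (calT ξ), s <+: t → g s = f (θ s) (e t) := by
  exact mainColor ξ f
end
end
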